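/- arXiv:1903.01052 — 3 statements merged into one kernel-verified Lean document; each statement's English description precedes it below -/
import Mathlib

section
/- Let g ∈ ℤ[x] be x²-divisible of degree d ≥ 3 and let α ∈ [−4L_g, 4L_g] be a real number such that g(x) ≠ u_d x^d or α ≠ 0. Then there exist δ with 0 < δ < L_g, a constant C > 0, and an integer N ≥ 0 such that for every c ∈ (α−δ, α+δ) ∩ S_g the following holds: if B̂_{n'} ≥ 2 for some n' ≥ 0, then there is a finite set S_c ⊆ ℕ with #S_c ≤ N + n' such that for every n ∉ S_c, ln|g_c^n(c)| ≥ min{(−1 + 1/d) ln B_n + ln C, ln δ}. -/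
open Polynomial

/-- The `n`-th iterate of `g_c := g + c` applied to `0`, for `g ∈ ℤ[x]` and `c ∈ ℚ`. -/
noncomputable def gcIter (g : ℤ[X]) (c : ℚ) (n : ℕ) : ℚ :=
  (fun x : ℚ => (g.map (Int.castRingHom ℚ)).eval x + c)^[n] 0

/-- `g` is `x²`-divisible: degree at least 2 and zero constant and linear coefficients. -/
def IsX2Divisible (g : ℤ[X]) : Prop :=
  2 ≤ g.natDegree ∧ g.coeff 0 = 0 ∧ g.coeff 1 = 0

/-- The length `L_g = 1 + ∑_{i=2}^{d-1} |u_i|/|u_d|` of an `x²`-divisible polynomial. -/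
noncomputable def Lg (g : ℤ[X]) : ℝ :=
  1 + ∑ i ∈ Finset.Ico 2 g.natDegree, (|g.coeff i| : ℝ) / (|g.leadingCoeff| : ℝ)

/-- `S_g`: the set of `c ∈ ℚ` such that the sequence `{g_c^n(0)}_{n ≥ 1}` takes
infinitely many values. -/
def Sg (g : ℤ[X]) : Set ℚ :=
  {c : ℚ | (Set.range fun n : ℕ => gcIter g c (n + 1)).Infinite}

/-- The numerator `A_n` of `g_c^{n+1}(0) = g_c^n(c) = A_n / B_n` in lowest terms. -/
noncomputable def An (g : ℤ[X]) (c : ℚ) (n : ℕ) : ℤ := (gcIter g c (n + 1)).num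

/-- The (positive) denominator `B_n` of `g_c^{n+1}(0) = g_c^n(c) = A_n / B_n`
in lowest terms. -/
noncomputable def Bn (g : ℤ[X]) (c : ℚ) (n : ℕ) : ℕ := (gcIter g c (n + 1)).den

/-- For a natural number `a`, the factor `â = ∏_{p ∈ I(a)} p^{val_p(a)}`, where
`I(a)` consists of the primes `p` with `val_p(a) > val_p(u_d)`. -/
noncomputable def hatB (g : ℤ[X]) (a : ℕ) : ℕ :=
  ∏ p ∈ a.primeFactors.filter
      (fun p => padicValInt p g.leadingCoeff < padicValNat p a),
    p ^ padicValNat p a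

/-- `g` has rapidly increasing numerators on `S`: there is an integer `N > 0` such that
for every `c ∈ S` there is a finite set `J_c ⊆ ℕ` with `#J_c ≤ N` such that for every
`n ≥ 1` outside `J_c` one has `ln |A_n| > ∑_{p ∣ n} ln |A_{n/p}|`. -/
def RapidlyIncreasingNumerators (g : ℤ[X]) (S : Set ℚ) : Prop :=
  ∃ N : ℕ, 0 < N ∧ ∀ c ∈ S, ∃ J : Finset ℕ, J.card ≤ N ∧
    ∀ n : ℕ, 1 ≤ n → n ∉ J →
      (∑ p ∈ n.primeFactors, Real.log |(An g c (n / p) : ℝ)|) <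
        Real.log |(An g c n : ℝ)|

section OrbitEstimates

variable {φ : ℝ → ℝ} {c K R : ℝ} {y : ℕ → ℝ} {k : ℕ}

/-- If `y n` is small, then the orbit after time `n` follows the orbit of `0`. -/
lemma abs_orbit_sub_le (hK : 1 ≤ K) (h0 : y 0 = 0) (hy : ∀ n, y (n + 1) = φ (y n) + c)
    (hlip : ∀ a b, |a| ≤ R + 1 → |b| ≤ R + 1 → |φ a - φ b| ≤ K * |a - b|)
    (hsq : ∀ x, |x| ≤ 1 → |φ x| ≤ K * x ^ 2) (hR : ∀ i ≤ k, |y i| ≤ R)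
    {n : ℕ} (hn : |y n| ≤ 1) (hs : K ^ k * y n ^ 2 ≤ 1) :
    ∀ j, j + 1 ≤ k → |y (n + (j + 1)) - y (j + 1)| ≤ K ^ (j + 1) * y n ^ 2 := by
  intro j
  induction j with
  | zero =>
    intro _
    have hφ : φ 0 = 0 := by
      have := hsq 0 (by simp)
      simpa using this
    have e : y (n + (0 + 1)) - y (0 + 1) = φ (y n) := by
      rw [← Nat.add_assoc, Nat.add_zero, hy, hy, h0, hφ]; ring
    rw [e]
    simpa using hsq _ hn
  | succ j ih =>
    intro hj
    have ih' := ih (by omega)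
    have hb := hR (j + 1) (by omega)
    have hp : K ^ (j + 1) * y n ^ 2 ≤ 1 :=
      (mul_le_mul_of_nonneg_right (pow_le_pow_right₀ hK (by omega)) (sq_nonneg _)).trans hs
    have ha : |y (n + (j + 1))| ≤ R + 1 := by
      have := abs_sub_abs_le_abs_sub (y (n + (j + 1))) (y (j + 1))
      linarith
    have e : y (n + (j + 1 + 1)) - y (j + 1 + 1) = φ (y (n + (j + 1))) - φ (y (j + 1)) := by
      rw [← Nat.add_assoc, hy, hy]; ring
    rw [e]
    calc _ ≤ K * |y (n + (j + 1)) - y (j + 1)| := hlip _ _ ha (by linarith)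
      _ ≤ K * (K ^ (j + 1) * y n ^ 2) := by gcongr
      _ = _ := by ring

/-- If `y k` is very small, then the orbit returns near `y k` at every multiple of `k`. -/
lemma abs_orbit_mul_mem (hK : 1 ≤ K) (h0 : y 0 = 0) (hy : ∀ n, y (n + 1) = φ (y n) + c)
    (hlip : ∀ a b, |a| ≤ R + 1 → |b| ≤ R + 1 → |φ a - φ b| ≤ K * |a - b|)
    (hsq : ∀ x, |x| ≤ 1 → |φ x| ≤ K * x ^ 2) (hR : ∀ i ≤ k, |y i| ≤ R)
    (hk : 1 ≤ k) (hε : 8 * K ^ k * |y k| ≤ 1) (j : ℕ) :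
    |y (j * k)| ≤ 2 * |y k| ∧ (1 ≤ j → |y k| / 2 ≤ |y (j * k)|) := by
  have hε0 := abs_nonneg (y k)
  have hKk : 1 ≤ K ^ k := one_le_pow₀ hK
  have hε1 : 8 * |y k| ≤ 1 := by nlinarith
  induction j with
  | zero => simp [h0]
  | succ j ih =>
    have hsq' : y (j * k) ^ 2 ≤ 4 * |y k| ^ 2 := by
      rw [← sq_abs]; nlinarith [ih.1, abs_nonneg (y (j * k))]
    have hp : K ^ k * y (j * k) ^ 2 ≤ |y k| / 2 := by
      calc _ ≤ K ^ k * (4 * |y k| ^ 2) := by gcongr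
        _ ≤ _ := by nlinarith
    obtain ⟨k', rfl⟩ : ∃ k', k = k' + 1 := ⟨k - 1, by omega⟩
    have h := abs_orbit_sub_le hK h0 hy hlip hsq hR (n := j * (k' + 1))
      (by linarith [ih.1]) (by linarith) k' le_rfl
    rw [show (j + 1) * (k' + 1) = j * (k' + 1) + (k' + 1) by ring]
    have h1 := abs_sub_abs_le_abs_sub (y (j * (k' + 1) + (k' + 1))) (y (k' + 1))
    have h2 := abs_sub_abs_le_abs_sub (y (k' + 1)) (y (j * (k' + 1) + (k' + 1)))
    rw [abs_sub_comm] at h2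
    exact ⟨by linarith, fun _ => by linarith⟩

/-- If `y k` is very small compared to the previous orbit points, then every later orbit point
is at least half as large as some earlier one, of index at most `k`. -/
lemma exists_half_abs_le_orbit (hK : 1 ≤ K) (h0 : y 0 = 0) (hy : ∀ n, y (n + 1) = φ (y n) + c)
    (hlip : ∀ a b, |a| ≤ R + 1 → |b| ≤ R + 1 → |φ a - φ b| ≤ K * |a - b|)
    (hsq : ∀ x, |x| ≤ 1 → |φ x| ≤ K * x ^ 2) (hR : ∀ i ≤ k, |y i| ≤ R)
    (hk : 1 ≤ k) (hε : 8 * K ^ k * |y k| ≤ 1)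
    (hsmall : ∀ r, r + 1 < k → 8 * K ^ k * |y k| ^ 2 ≤ |y (r + 1)|) {n : ℕ} (hn : k < n) :
    ∃ r < k, |y (r + 1)| / 2 ≤ |y n| := by
  have hε0 := abs_nonneg (y k)
  have hKk : 1 ≤ K ^ k := one_le_pow₀ hK
  have hε1 : 8 * |y k| ≤ 1 := by nlinarith
  have hmod := Nat.mod_lt n hk
  have hdiv := Nat.div_add_mod' n k
  have hq := abs_orbit_mul_mem hK h0 hy hlip hsq hR hk hε (n / k)
  rcases h : n % k with _ | r
  · rw [h, add_zero] at hdiv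
    refine ⟨k - 1, by omega, ?_⟩
    rw [Nat.sub_add_cancel hk]
    rw [hdiv] at hq
    exact hq.2 ((Nat.one_le_div_iff hk).2 hn.le)
  · rw [h] at hmod hdiv
    refine ⟨r, by omega, ?_⟩
    have hsq' : y (n / k * k) ^ 2 ≤ 4 * |y k| ^ 2 := by
      rw [← sq_abs]; nlinarith [hq.1, abs_nonneg (y (n / k * k))]
    have hp : K ^ k * y (n / k * k) ^ 2 ≤ 4 * K ^ k * |y k| ^ 2 := by
      calc _ ≤ K ^ k * (4 * |y k| ^ 2) := by gcongr
        _ = _ := by ring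
    have hs := abs_orbit_sub_le hK h0 hy hlip hsq hR (n := n / k * k)
      (by linarith [hq.1]) (by nlinarith) r hmod.le
    have hp' : K ^ (r + 1) * y (n / k * k) ^ 2 ≤ K ^ k * y (n / k * k) ^ 2 :=
      mul_le_mul_of_nonneg_right (pow_le_pow_right₀ hK hmod.le) (sq_nonneg _)
    rw [hdiv] at hs
    have h2 := abs_sub_abs_le_abs_sub (y (r + 1)) (y n)
    rw [abs_sub_comm] at h2
    linarith [hsmall r hmod]

/-- An orbit that comes back below the escape radius has never exceeded it. -/
lemma abs_orbit_le_of_abs_le (hy : ∀ n, y (n + 1) = φ (y n) + c)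
    (hesc : ∀ x, R < |x| → R < |φ x + c|) (hk : |y k| ≤ R) : ∀ i ≤ k, |y i| ≤ R := by
  intro i hi
  by_contra! h
  have : ∀ m, R < |y (i + m)| := by
    intro m
    induction m with
    | zero => exact h
    | succ m ih => rw [← Nat.add_assoc, hy]; exact hesc _ ih
  have := this (k - i)
  rw [Nat.add_sub_cancel' hi] at this
  linarith

end OrbitEstimates

section PolynomialBounds

lemma exists_lipschitz_bound (p : ℝ[X]) (R : ℝ) :
    ∃ K, ∀ a b, |a| ≤ R → |b| ≤ R → |p.eval a - p.eval b| ≤ K * |a - b| := by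
  obtain ⟨K, hK⟩ := (isCompact_Icc (a := -R) (b := R)).exists_bound_of_continuousOn
    p.derivative.continuous.continuousOn
  refine ⟨K, fun a b ha hb => ?_⟩
  refine (convex_Icc (-R) R).norm_image_sub_le_of_norm_deriv_le (f := fun x => p.eval x)
    (fun x _ => p.differentiableAt) (fun x hx => ?_) (abs_le.1 hb) (abs_le.1 ha)
  rw [Polynomial.deriv]
  exact hK x hx

lemma exists_quadratic_bound (p : ℝ[X]) (h0 : p.coeff 0 = 0) (h1 : p.coeff 1 = 0) :
    ∃ K, ∀ x, |x| ≤ 1 → |p.eval x| ≤ K * x ^ 2 := by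
  obtain ⟨q, rfl⟩ : X ^ 2 ∣ p := by
    rw [X_pow_dvd_iff]
    intro i hi
    interval_cases i <;> assumption
  obtain ⟨K, hK⟩ := (isCompact_Icc (a := (-1 : ℝ)) (b := 1)).exists_bound_of_continuousOn
    q.continuous.continuousOn
  refine ⟨K, fun x hx => ?_⟩
  have := hK x (abs_le.1 hx)
  rw [Real.norm_eq_abs] at this
  rw [eval_mul, abs_mul, eval_pow, eval_X, abs_of_nonneg (sq_nonneg x), mul_comm]
  gcongr

lemma exists_escape_radius (p : ℝ[X]) (hd : 2 ≤ p.natDegree) (h0 : p.coeff 0 = 0) (D : ℝ) :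
    ∃ R, ∀ R' ≥ R, ∀ c, |c| ≤ D → ∀ x, R' < |x| → R' < |p.eval x + c| := by
  have hq : 0 < p.divX.degree := by
    rw [← natDegree_pos_iff_degree_pos, natDegree_divX_eq_natDegree_tsub_one]; omega
  have ht := tendsto_norm_atTop p.divX hq (l := Filter.comap (fun x : ℝ => |x|) Filter.atTop)
    (z := id) Filter.tendsto_comap
  have he := ht.eventually (Filter.eventually_ge_atTop (|D| + 1))
  rw [Filter.eventually_comap] at he
  obtain ⟨R, hR⟩ := Filter.eventually_atTop.1 he
  refine ⟨max R 1, fun R' hR' c hc x hx => ?_⟩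
  have hx1 : 1 ≤ |x| := (le_max_right _ _).trans (hR'.trans hx.le)
  have h := hR |x| ((le_max_left _ _).trans (hR'.trans hx.le)) x rfl
  have e : p.eval x = p.divX.eval x * x := by
    conv_lhs => rw [← divX_mul_X_add p, h0]
    simp
  have h1 := abs_sub_abs_le_abs_sub (p.eval x) (-c)
  rw [sub_neg_eq_add, abs_neg, e, abs_mul] at h1
  rw [e]
  simp only [id, Real.norm_eq_abs] at h
  nlinarith [le_abs_self D, abs_nonneg D]

end PolynomialBounds
section Denominators

lemma max_one_padicNorm (p : ℕ) [hp : Fact p.Prime] (q : ℚ) :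
    max 1 (padicNorm p q) = (p : ℚ) ^ q.den.factorization p := by
  have hq : padicNorm p q = padicNorm p q.num / padicNorm p q.den := by
    rw [← padicNorm.div, Rat.num_div_den]
  by_cases h : p ∣ q.den
  · have hnum : padicNorm p q.num = 1 := by
      rw [padicNorm.int_eq_one_iff, Int.natCast_dvd]
      intro h'
      exact Nat.not_coprime_of_dvd_of_dvd hp.out.one_lt h' h q.reduced
    have hden : padicNorm p q.den = ((p : ℚ) ^ q.den.factorization p)⁻¹ := by
      rw [padicNorm.eq_zpow_of_nonzero (by exact_mod_cast q.den_nz), padicValRat.of_nat,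
        Nat.factorization_def _ hp.out, zpow_neg, zpow_natCast]
    rw [hq, hnum, hden, one_div, inv_inv, max_eq_right]
    exact one_le_pow₀ (by exact_mod_cast hp.out.one_lt.le)
  · rw [Nat.factorization_eq_zero_of_not_dvd h, pow_zero, hq,
      (padicNorm.nat_eq_one_iff q.den).2 h, div_one, max_eq_left (padicNorm.of_int _)]

lemma padicNorm_intCast_eq (p : ℕ) [hp : Fact p.Prime] {u : ℤ} (hu : u ≠ 0) :
    padicNorm p u = ((p : ℚ) ^ u.natAbs.factorization p)⁻¹ := by
  rw [padicNorm.eq_zpow_of_nonzero (by exact_mod_cast hu), padicValRat.of_int,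
    Nat.factorization_def _ hp.out, zpow_neg, zpow_natCast]
  rfl

lemma padicNorm_eval_add (p : ℕ) [hp : Fact p.Prime] {g : ℤ[X]} (hd : 2 ≤ g.natDegree) {x c : ℚ}
    (hx : 1 < padicNorm p g.leadingCoeff * padicNorm p x) (hc : padicNorm p c ≤ padicNorm p x) :
    padicNorm p ((g.map (Int.castRingHom ℚ)).eval x + c) =
      padicNorm p g.leadingCoeff * padicNorm p x ^ g.natDegree := by
  have hpow : ∀ i, padicNorm p (x ^ i) = padicNorm p x ^ i := fun i => by
    induction i with
    | zero => simp
    | succ i ih => rw [pow_succ, padicNorm.mul, ih, pow_succ]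
  have hu1 := padicNorm.of_int (p := p) g.leadingCoeff
  have hN1 : 1 ≤ padicNorm p x := by
    nlinarith [padicNorm.nonneg (p := p) x]
  obtain ⟨e, he⟩ : ∃ e, g.natDegree = e + 1 := ⟨g.natDegree - 1, by omega⟩
  have hsum : (g.map (Int.castRingHom ℚ)).eval x + c =
      (∑ i ∈ Finset.range g.natDegree, (g.coeff i : ℚ) * x ^ i + c) +
        g.leadingCoeff * x ^ g.natDegree := by
    rw [eval_map, eval₂_eq_sum_range, Finset.sum_range_succ]
    simp only [eq_intCast, coeff_natDegree]
    ring
  have hlow : padicNorm p (∑ i ∈ Finset.range g.natDegree, (g.coeff i : ℚ) * x ^ i + c) ≤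
      padicNorm p x ^ e := by
    refine padicNorm.nonarchimedean.trans (max_le (padicNorm.sum_le' (fun i hi => ?_) ?_) ?_)
    · rw [padicNorm.mul, hpow]
      have hi' : i ≤ e := by have := Finset.mem_range.1 hi; omega
      calc _ ≤ 1 * padicNorm p x ^ i := by
            gcongr
            exact padicNorm.of_int _
        _ ≤ _ := by rw [one_mul]; exact pow_le_pow_right₀ hN1 hi'
    · positivity
    · exact hc.trans (le_self_pow₀ hN1 (by omega))
  have hlead : padicNorm p (g.leadingCoeff * x ^ g.natDegree) =
      padicNorm p g.leadingCoeff * padicNorm p x ^ g.natDegree := by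
    rw [padicNorm.mul, hpow]
  have hlt : padicNorm p x ^ e < padicNorm p g.leadingCoeff * padicNorm p x ^ g.natDegree := by
    rw [he, pow_succ]
    nlinarith [one_le_pow₀ hN1 (n := e)]
  rw [hsum, padicNorm.add_eq_max_of_ne, max_eq_right, hlead]
  · rw [hlead]; exact hlow.trans hlt.le
  · rw [hlead]; exact (hlow.trans_lt hlt).ne

lemma factorization_den_eval_add {p : ℕ} (hp : p.Prime) {g : ℤ[X]} (hd : 2 ≤ g.natDegree)
    {x c : ℚ} (hx : g.leadingCoeff.natAbs.factorization p < x.den.factorization p)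
    (hc : c.den.factorization p ≤ x.den.factorization p) :
    ((g.map (Int.castRingHom ℚ)).eval x + c).den.factorization p +
      g.leadingCoeff.natAbs.factorization p = g.natDegree * x.den.factorization p := by
  have : Fact p.Prime := ⟨hp⟩
  have hp1 : (1 : ℚ) < p := by exact_mod_cast hp.one_lt
  have hu : g.leadingCoeff ≠ 0 := by
    rw [Ne, leadingCoeff_eq_zero]; rintro rfl; simp at hd
  set w := g.leadingCoeff.natAbs.factorization p with hw
  set v := x.den.factorization p with hv
  have hux := padicNorm_intCast_eq p hu
  rw [← hw] at hux
  have hxN := max_one_padicNorm p x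
  rw [← hv] at hxN
  have hv1 : (1 : ℚ) < (p : ℚ) ^ v := one_lt_pow₀ hp1 (by omega)
  have hxv : padicNorm p x = (p : ℚ) ^ v := by
    rcases le_total (padicNorm p x) 1 with h | h
    · rw [max_eq_left h] at hxN; linarith
    · rwa [max_eq_right h] at hxN
  have hcN : padicNorm p c ≤ padicNorm p x := by
    rw [hxv]
    calc _ ≤ max 1 (padicNorm p c) := le_max_right _ _
      _ = _ := max_one_padicNorm p c
      _ ≤ _ := pow_le_pow_right₀ hp1.le hc
  have hpw : (0 : ℚ) < (p : ℚ) ^ w := by positivity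
  have hmul : 1 < padicNorm p g.leadingCoeff * padicNorm p x := by
    rw [hux, hxv, inv_mul_eq_div, one_lt_div hpw]
    exact pow_lt_pow_right₀ hp1 hx
  have key := padicNorm_eval_add p hd hmul hcN
  rw [hux, hxv, ← pow_mul] at key
  have hwv : w ≤ v * g.natDegree := hx.le.trans (Nat.le_mul_of_pos_right _ (by omega))
  have h1 : 1 ≤ ((p : ℚ) ^ w)⁻¹ * (p : ℚ) ^ (v * g.natDegree) := by
    rw [inv_mul_eq_div, one_le_div hpw]
    exact pow_le_pow_right₀ hp1.le hwv
  have hm := max_one_padicNorm p ((g.map (Int.castRingHom ℚ)).eval x + c)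
  rw [key, max_eq_right h1, inv_mul_eq_div, div_eq_iff hpw.ne', ← pow_add] at hm
  have := pow_right_injective₀ (by positivity) hp1.ne' hm
  rw [← this, mul_comm]

variable {g : ℤ[X]} {c : ℚ}

lemma gcIter_zero : gcIter g c 0 = 0 := rfl

lemma gcIter_succ (n : ℕ) :
    gcIter g c (n + 1) = (g.map (Int.castRingHom ℚ)).eval (gcIter g c n) + c := by
  rw [gcIter, Function.iterate_succ_apply']
  rfl

lemma Bn_ne_zero (n : ℕ) : Bn g c n ≠ 0 := Rat.den_nz _

lemma Bn_zero (h0 : g.coeff 0 = 0) : Bn g c 0 = c.den := by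
  rw [Bn, gcIter_succ, gcIter_zero, ← coeff_zero_eq_eval_zero, coeff_map, h0]
  simp

lemma factorization_Bn_zero_le (hg : IsX2Divisible g) {p : ℕ} (hp : p.Prime) (n : ℕ) :
    c.den.factorization p ≤
      max ((Bn g c n).factorization p) (g.leadingCoeff.natAbs.factorization p) := by
  induction n with
  | zero => rw [Bn_zero hg.2.1]; exact le_max_left _ _
  | succ n ih =>
    rcases le_or_gt ((Bn g c n).factorization p) (g.leadingCoeff.natAbs.factorization p) with h | h
    · exact le_max_of_le_right (by rwa [max_eq_right h] at ih)
    · rw [max_eq_left h.le] at ih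
      have := factorization_den_eval_add hp hg.1 h ih
      rw [← gcIter_succ] at this
      change (Bn g c (n + 1)).factorization p + _ = _ * (Bn g c n).factorization p at this
      have := Nat.mul_le_mul_right ((Bn g c n).factorization p) hg.1
      exact le_max_of_le_left (by omega)

lemma factorization_Bn_succ (hg : IsX2Divisible g) {p : ℕ} (hp : p.Prime) {n : ℕ}
    (h : g.leadingCoeff.natAbs.factorization p < (Bn g c n).factorization p) :
    (Bn g c (n + 1)).factorization p + g.leadingCoeff.natAbs.factorization p =
      g.natDegree * (Bn g c n).factorization p := by
  have hc := factorization_Bn_zero_le (c := c) hg hp n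
  rw [max_eq_left h.le] at hc
  have := factorization_den_eval_add hp hg.1 h hc
  rwa [← gcIter_succ] at this

lemma leadingCoeff_natAbs_ne_zero (hg : IsX2Divisible g) : g.leadingCoeff.natAbs ≠ 0 := by
  rw [Int.natAbs_ne_zero, Ne, leadingCoeff_eq_zero]
  rintro rfl
  simpa using hg.1

lemma Bn_pow_dvd (hg : IsX2Divisible g) (n : ℕ) :
    Bn g c n ^ g.natDegree ∣ g.leadingCoeff.natAbs ^ g.natDegree * Bn g c (n + 1) := by
  have hu := leadingCoeff_natAbs_ne_zero hg
  rw [← Nat.factorization_prime_le_iff_dvd (pow_ne_zero _ (Bn_ne_zero n))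
    (mul_ne_zero (pow_ne_zero _ hu) (Bn_ne_zero _))]
  intro p hp
  rw [Nat.factorization_mul (pow_ne_zero _ hu) (Bn_ne_zero _), Nat.factorization_pow,
    Nat.factorization_pow]
  simp only [Finsupp.add_apply, Finsupp.smul_apply, smul_eq_mul]
  rcases le_or_gt ((Bn g c n).factorization p) (g.leadingCoeff.natAbs.factorization p) with h | h
  · have := Nat.mul_le_mul_left g.natDegree h
    omega
  · have := factorization_Bn_succ hg hp h
    have := Nat.le_mul_of_pos_left (g.leadingCoeff.natAbs.factorization p)
      (show 0 < g.natDegree by have := hg.1; omega)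
    omega

lemma lt_factorization_Bn_add (hg : IsX2Divisible g) (hd : 3 ≤ g.natDegree) {p : ℕ}
    (hp : p.Prime) {n : ℕ}
    (h : g.leadingCoeff.natAbs.factorization p < (Bn g c n).factorization p) (t : ℕ) :
    2 ^ t * (Bn g c n).factorization p ≤ (Bn g c (n + t)).factorization p := by
  induction t with
  | zero => simp
  | succ t ih =>
    have h' : g.leadingCoeff.natAbs.factorization p < (Bn g c (n + t)).factorization p :=
      h.trans_le ((Nat.le_mul_of_pos_left _ (by positivity)).trans ih)
    have e := factorization_Bn_succ hg hp h'
    have := Nat.mul_le_mul_right ((Bn g c (n + t)).factorization p) hd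
    rw [← Nat.add_assoc, pow_succ]
    nlinarith

lemma Bn_dvd (hg : IsX2Divisible g) (hd : 3 ≤ g.natDegree) (n t : ℕ) :
    Bn g c n ∣ g.leadingCoeff.natAbs * Bn g c (n + t) := by
  have hu := leadingCoeff_natAbs_ne_zero hg
  rw [← Nat.factorization_prime_le_iff_dvd (Bn_ne_zero n) (mul_ne_zero hu (Bn_ne_zero _))]
  intro p hp
  rw [Nat.factorization_mul hu (Bn_ne_zero _), Finsupp.add_apply]
  rcases le_or_gt ((Bn g c n).factorization p) (g.leadingCoeff.natAbs.factorization p) with h | h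
  · omega
  · have h1 := lt_factorization_Bn_add hg hd hp h t
    have h2 := Nat.le_mul_of_pos_left ((Bn g c n).factorization p) (pow_pos two_pos t)
    omega

lemma two_pow_le_Bn (hg : IsX2Divisible g) (hd : 3 ≤ g.natDegree) {n : ℕ}
    (h : ¬ Bn g c n ∣ g.leadingCoeff.natAbs) (t : ℕ) : 2 ^ 2 ^ t ≤ Bn g c (n + t) := by
  rw [← Nat.factorization_prime_le_iff_dvd (Bn_ne_zero n) (leadingCoeff_natAbs_ne_zero hg)] at h
  push Not at h
  obtain ⟨p, hp, h⟩ := h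
  have h1 := lt_factorization_Bn_add hg hd hp h t
  calc 2 ^ 2 ^ t ≤ p ^ 2 ^ t := Nat.pow_le_pow_left hp.two_le _
    _ ≤ p ^ (Bn g c (n + t)).factorization p :=
        Nat.pow_le_pow_right hp.pos ((Nat.le_mul_of_pos_right _ (by omega)).trans h1)
    _ ≤ _ := Nat.ordProj_le p (Bn_ne_zero _)

lemma Bn_pow_le (hg : IsX2Divisible g) (hd : 3 ≤ g.natDegree) {r n : ℕ} (h : r < n) :
    Bn g c r ^ g.natDegree ≤ g.leadingCoeff.natAbs ^ (g.natDegree + 1) * Bn g c n := by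
  have hu := leadingCoeff_natAbs_ne_zero hg
  obtain ⟨t, rfl⟩ := Nat.exists_eq_add_of_lt h
  have h2 := Bn_dvd (c := c) hg hd (r + 1) t
  rw [show r + 1 + t = r + t + 1 by omega] at h2
  have h3 := (Bn_pow_dvd (c := c) hg r).trans (mul_dvd_mul_left _ h2)
  rw [← mul_assoc, ← pow_succ] at h3
  exact Nat.le_of_dvd (by have := Bn_ne_zero (g := g) (c := c) (r + t + 1); positivity) h3

lemma gcIter_injective (hc : c ∈ Sg g) : Function.Injective (gcIter g c) := by
  intro i j hij
  by_contra hne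
  wlog h : i < j generalizing i j
  · exact this hij.symm (Ne.symm hne) (by omega)
  refine hc (((Finset.range j).image (gcIter g c)).finite_toSet.subset ?_)
  have hall : ∀ n, gcIter g c n ∈ (Finset.range j).image (gcIter g c) := by
    intro n
    induction n with
    | zero => exact Finset.mem_image_of_mem _ (Finset.mem_range.2 (by omega))
    | succ n ih =>
      obtain ⟨m, hm, hmn⟩ := Finset.mem_image.1 ih
      rw [gcIter_succ, ← hmn, ← gcIter_succ]
      rcases lt_or_eq_of_le (Nat.succ_le_of_lt (Finset.mem_range.1 hm)) with h' | h'
      · exact Finset.mem_image_of_mem _ (Finset.mem_range.2 h')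
      · rw [show m + 1 = j from h', ← hij]
        exact Finset.mem_image_of_mem _ (Finset.mem_range.2 h)
  rintro _ ⟨n, rfl⟩
  exact hall _

/-- A bounded stretch of an infinite orbit contains a point whose denominator does not divide
the leading coefficient. -/
lemma exists_not_Bn_dvd (hc : c ∈ Sg g) {R : ℝ} {m : ℕ}
    (hm : (g.leadingCoeff.natAbs : ℝ) * R ≤ m)
    (hR : ∀ i ≤ 2 * m + 1, |(gcIter g c (i + 1) : ℝ)| ≤ R) :
    ∃ i ≤ 2 * m + 1, ¬ Bn g c i ∣ g.leadingCoeff.natAbs := by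
  by_contra! hall
  set u := g.leadingCoeff.natAbs with hu
  by_cases hu0 : u = 0
  · have hg0 : g = 0 := by rwa [hu, Int.natAbs_eq_zero, leadingCoeff_eq_zero] at hu0
    have h12 : gcIter g c 1 = gcIter g c 2 := by
      rw [gcIter_succ, gcIter_succ, hg0]; simp
    exact absurd (gcIter_injective hc h12) (by norm_num)
  have hz : ∀ i ≤ 2 * m + 1, ∃ z : ℤ, (z : ℚ) = u * gcIter g c (i + 1) := by
    intro i hi
    obtain ⟨k, hk⟩ := hall i hi
    refine ⟨k * (gcIter g c (i + 1)).num, ?_⟩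
    have hden : ((gcIter g c (i + 1)).den : ℚ) ≠ 0 := by exact_mod_cast Rat.den_nz _
    rw [hk, Bn]
    push_cast
    rw [mul_assoc, mul_left_comm, Rat.den_mul_eq_num]
  choose! z hz using hz
  have hmaps : ∀ i ∈ Finset.range (2 * m + 2), z i ∈ Finset.Icc (-(m : ℤ)) m := by
    intro i hi
    have hi' : i ≤ 2 * m + 1 := by have := Finset.mem_range.1 hi; omega
    rw [Finset.mem_Icc, ← abs_le]
    have e : (z i : ℝ) = u * (gcIter g c (i + 1) : ℝ) := by exact_mod_cast hz i hi'
    have : |(z i : ℝ)| ≤ m := by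
      rw [e, abs_mul, Nat.abs_cast]
      exact (mul_le_mul_of_nonneg_left (hR i hi') (Nat.cast_nonneg _)).trans hm
    exact_mod_cast this
  obtain ⟨i, hi, j, hj, hij, he⟩ := Finset.exists_ne_map_eq_of_card_lt_of_maps_to
    (by simp; omega) hmaps
  have hi' : i ≤ 2 * m + 1 := by have := Finset.mem_range.1 hi; omega
  have hj' : j ≤ 2 * m + 1 := by have := Finset.mem_range.1 hj; omega
  have e : (u : ℚ) * gcIter g c (i + 1) = u * gcIter g c (j + 1) := by
    rw [← hz i hi', ← hz j hj', he]
  have := gcIter_injective hc (mul_left_cancel₀ (by exact_mod_cast hu0) e)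
  omega

lemma one_div_Bn_le (hc : c ∈ Sg g) (n : ℕ) : 1 / (Bn g c n : ℝ) ≤ |(gcIter g c (n + 1) : ℝ)| := by
  have hne : gcIter g c (n + 1) ≠ 0 := fun h =>
    absurd (gcIter_injective hc (h.trans gcIter_zero.symm)) (by omega)
  have h1 : (1 : ℝ) ≤ |((gcIter g c (n + 1)).num : ℝ)| := by
    exact_mod_cast Int.one_le_abs (Rat.num_ne_zero.2 hne)
  rw [Rat.cast_def, abs_div, Nat.abs_cast]
  exact div_le_div_of_nonneg_right h1 (Nat.cast_nonneg _)

end Denominators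

/-- Doubly exponential growth beats simply exponential growth. -/
lemma exists_forall_mul_pow_le_two_pow (M Q : ℝ) (hQ : 1 ≤ Q) :
    ∃ T : ℕ, ∀ t ≥ T, M * Q ^ t ≤ (2 : ℝ) ^ 2 ^ t := by
  obtain ⟨a, ha⟩ := pow_unbounded_of_one_lt (max M Q) (one_lt_two (α := ℝ))
  have hlim := (tendsto_pow_const_div_const_pow_of_one_lt 1 (one_lt_two (α := ℝ)))
  have hev := hlim.eventually (Iio_mem_nhds (show (0 : ℝ) < 1 / (2 * (a + 1)) by positivity))
  obtain ⟨T, hT⟩ := Filter.eventually_atTop.1 hev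
  refine ⟨T + 1, fun t ht => ?_⟩
  have h := hT t (by omega)
  rw [div_lt_div_iff₀ (by positivity) (by positivity)] at h
  have h' : a + a * t ≤ 2 ^ t := by
    have h2 : t * (2 * (a + 1)) < 2 ^ t := by
      have : (t : ℝ) * (2 * (a + 1)) < 2 ^ t := by simpa using h
      exact_mod_cast this
    nlinarith
  calc M * Q ^ t ≤ 2 ^ a * (2 ^ a) ^ t := by
        gcongr
        · exact (le_max_left _ _).trans ha.le
        · exact (le_max_right _ _).trans ha.le
    _ = 2 ^ (a + a * t) := by rw [← pow_mul, ← pow_add]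
    _ ≤ _ := pow_le_pow_right₀ one_le_two h'

lemma le_mul_rpow_of_pow_le {a b U : ℝ} {d : ℕ} (hd : 2 ≤ d) (ha : 1 ≤ a) (hb : 0 ≤ b)
    (hU : 1 ≤ U) (h : a ^ d ≤ U * b) : a ≤ U * b ^ (1 - 1 / (d : ℝ)) := by
  have hd' : (2 : ℝ) ≤ d := by exact_mod_cast hd
  have hs0 : 0 ≤ 1 - 1 / (d : ℝ) := by
    rw [sub_nonneg, div_le_one (by linarith)]; linarith
  have hs1 : 1 - 1 / (d : ℝ) ≤ 1 := by
    have : 0 ≤ 1 / (d : ℝ) := by positivity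
    linarith
  have e : (a ^ d) ^ (1 - 1 / (d : ℝ)) = a ^ ((d : ℝ) - 1) := by
    rw [← Real.rpow_natCast, ← Real.rpow_mul (by linarith)]
    congr 1
    field_simp
  calc a = a ^ (1 : ℝ) := (Real.rpow_one a).symm
    _ ≤ a ^ ((d : ℝ) - 1) := Real.rpow_le_rpow_of_exponent_le ha (by linarith)
    _ = (a ^ d) ^ (1 - 1 / (d : ℝ)) := e.symm
    _ ≤ (U * b) ^ (1 - 1 / (d : ℝ)) := Real.rpow_le_rpow (by positivity) h hs0
    _ = U ^ (1 - 1 / (d : ℝ)) * b ^ (1 - 1 / (d : ℝ)) := Real.mul_rpow (by linarith) hb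
    _ ≤ U ^ (1 : ℝ) * b ^ (1 - 1 / (d : ℝ)) := by
        gcongr
    _ = _ := by rw [Real.rpow_one]

/-- A form of `e < b ^ (-1 + 1 / d)`, `M ^ 3 ≤ b` free of real exponents. -/
lemma mul_le_one_of_lt_rpow {b e M : ℝ} {d : ℕ} (hd : 3 ≤ d) (hb : 1 ≤ b)
    (hMb : M ^ 3 ≤ b) (he0 : 0 ≤ e) (he : e < b ^ (-1 + 1 / (d : ℝ))) :
    M * e ≤ 1 ∧ M * e ^ 2 * b ≤ 1 := by
  have hd' : (3 : ℝ) ≤ d := by exact_mod_cast hd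
  set t := b ^ (1 / 3 : ℝ) with ht
  have ht3 : t ^ 3 = b := by
    rw [ht, ← Real.rpow_natCast, ← Real.rpow_mul (by linarith)]; norm_num
  have ht1 : 1 ≤ t := Real.one_le_rpow hb (by norm_num)
  have hMt : M ≤ t := by
    rw [← ht3] at hMb
    exact le_of_pow_le_pow_left₀ (by norm_num) (by linarith) hMb
  have he' : e ≤ (t ^ 2)⁻¹ := by
    have : (t ^ 2)⁻¹ = b ^ (-2 / 3 : ℝ) := by
      rw [ht, ← Real.rpow_natCast, ← Real.rpow_mul (by linarith), ← Real.rpow_neg (by linarith)]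
      norm_num
    rw [this]
    refine he.le.trans (Real.rpow_le_rpow_of_exponent_le hb ?_)
    have : 1 / (d : ℝ) ≤ 1 / 3 := one_div_le_one_div_of_le (by norm_num) hd'
    linarith
  have het : e * t ^ 2 ≤ 1 := by
    rwa [← le_div_iff₀ (by positivity), one_div]
  refine ⟨?_, ?_⟩
  · calc M * e ≤ t ^ 2 * e := by gcongr; nlinarith
      _ ≤ 1 := by linarith
  · calc M * e ^ 2 * b ≤ t * e ^ 2 * b := by gcongr
      _ = (e * t ^ 2) ^ 2 := by rw [← ht3]; ring
      _ ≤ 1 := pow_le_one₀ (by positivity) het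

/-- For parameters in a bounded set, at most one late orbit point can be very small. -/
lemma exists_at_most_one_small_iterate (g : ℤ[X]) (hg : IsX2Divisible g) (hd : 3 ≤ g.natDegree)
    (D δ : ℝ) :
    ∃ C : ℝ, 0 < C ∧ ∃ N : ℕ, ∀ c ∈ Sg g, |(c : ℝ)| ≤ D → ∀ k n, N ≤ k → k < n →
      |(gcIter g c (k + 1) : ℝ)| < C * (Bn g c k : ℝ) ^ (-1 + 1 / (g.natDegree : ℝ)) →
      |(gcIter g c (k + 1) : ℝ)| < δ →
      C * (Bn g c n : ℝ) ^ (-1 + 1 / (g.natDegree : ℝ)) ≤ |(gcIter g c (n + 1) : ℝ)| := by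
  have hu := leadingCoeff_natAbs_ne_zero hg
  set d := g.natDegree
  set u := g.leadingCoeff.natAbs
  set P : ℝ[X] := g.map (Int.castRingHom ℝ) with hP
  have hP0 : P.coeff 0 = 0 := by rw [hP, coeff_map, hg.2.1]; simp
  have hP1 : P.coeff 1 = 0 := by rw [hP, coeff_map, hg.2.2]; simp
  have hPd : 2 ≤ P.natDegree := by
    rw [hP, natDegree_map_eq_of_injective (RingHom.injective_int _)]; exact hg.1
  obtain ⟨R₀, hR₀⟩ := exists_escape_radius P hPd hP0 D
  set R := max R₀ δ
  have hesc := hR₀ R (le_max_left _ _)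
  have hRδ : δ ≤ R := le_max_right _ _
  obtain ⟨K₁, hK₁⟩ := exists_lipschitz_bound P (R + 1)
  obtain ⟨K₂, hK₂⟩ := exists_quadratic_bound P hP0 hP1
  set K := max 1 (max K₁ K₂)
  have hK : 1 ≤ K := le_max_left _ _
  have hlip : ∀ a b, |a| ≤ R + 1 → |b| ≤ R + 1 → |P.eval a - P.eval b| ≤ K * |a - b| := by
    intro a b ha hb
    refine (hK₁ a b ha hb).trans (mul_le_mul_of_nonneg_right ?_ (abs_nonneg _))
    exact (le_max_left _ _).trans (le_max_right _ _)
  have hsq : ∀ x, |x| ≤ 1 → |P.eval x| ≤ K * x ^ 2 := by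
    intro x hx
    refine (hK₂ x hx).trans (mul_le_mul_of_nonneg_right ?_ (sq_nonneg _))
    exact (le_max_right _ _).trans (le_max_right _ _)
  set U : ℝ := (u : ℝ) ^ (d + 1) with hU_def
  have hu1 : (1 : ℝ) ≤ u := by exact_mod_cast Nat.one_le_iff_ne_zero.2 hu
  have hU : 1 ≤ U := one_le_pow₀ hu1
  set m := ⌈(u : ℝ) * R⌉₊
  have hKpos : ∀ i, 1 ≤ K ^ i := fun i => one_le_pow₀ hK
  obtain ⟨T, hT⟩ := exists_forall_mul_pow_le_two_pow
    ((8 * U * K ^ (2 * m + 2)) ^ 3) (K ^ 3) (one_le_pow₀ hK)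
  refine ⟨1 / (2 * U), by positivity, T + (2 * m + 1), ?_⟩
  intro c hc hcD k n hk hkn hsmall hsmallδ
  set y : ℕ → ℝ := fun n => (gcIter g c n : ℝ) with hy_def
  have hy0 : y 0 = 0 := by simp [hy_def, gcIter_zero]
  have hy : ∀ n, y (n + 1) = P.eval (y n) + c := by
    intro n
    simp only [hy_def, gcIter_succ, hP, Rat.cast_add, eval_map, eval₂_eq_sum_range]
    push_cast
    simp
  have hB1 : ∀ n, (1 : ℝ) ≤ Bn g c n := fun n => by
    exact_mod_cast Nat.one_le_iff_ne_zero.2 (Bn_ne_zero n)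
  have hR : ∀ i ≤ k + 1, |y i| ≤ R :=
    abs_orbit_le_of_abs_le hy (hesc c hcD) (hsmallδ.le.trans hRδ)
  have hBpow : ∀ r j, r < j → (Bn g c r : ℝ) ^ d ≤ U * Bn g c j := fun r j hrj => by
    rw [hU_def]
    exact_mod_cast Bn_pow_le (c := c) hg hd hrj
  have hBle : ∀ r j, r < j → (Bn g c r : ℝ) ≤ U * Bn g c j := fun r j hrj =>
    (le_self_pow₀ (hB1 r) (by omega)).trans (hBpow r j hrj)
  have hgrow : (8 * U * K ^ (k + 1)) ^ 3 ≤ Bn g c k := by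
    obtain ⟨i, hi, hin⟩ := exists_not_Bn_dvd (m := m) hc (Nat.le_ceil _)
      (fun i hi => hR (i + 1) (by omega))
    have h1 := two_pow_le_Bn hg hd hin (k - i)
    rw [Nat.add_sub_cancel' (by omega)] at h1
    have h2 := hT (k - (2 * m + 1)) (by omega)
    have h3 : (2 : ℝ) ^ 2 ^ (k - (2 * m + 1)) ≤ 2 ^ 2 ^ (k - i) :=
      pow_le_pow_right₀ one_le_two (Nat.pow_le_pow_right two_pos (by omega))
    have h4 : ((2 : ℝ) ^ 2 ^ (k - i)) ≤ Bn g c k := by exact_mod_cast h1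
    refine le_trans (le_of_eq ?_) (h2.trans (h3.trans h4))
    rw [pow_right_comm, ← mul_pow, mul_assoc _ (K ^ (2 * m + 2)), ← pow_add,
      show 2 * m + 2 + (k - (2 * m + 1)) = k + 1 by omega]
  have hC1 : 1 / (2 * U) ≤ 1 := by rw [div_le_one (by positivity)]; linarith
  have hlt : |y (k + 1)| < (Bn g c k : ℝ) ^ (-1 + 1 / (d : ℝ)) :=
    hsmall.trans_le (mul_le_of_le_one_left (by positivity) hC1)
  obtain ⟨hε1, hε2⟩ := mul_le_one_of_lt_rpow hd (hB1 k) hgrow (abs_nonneg _) hlt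
  obtain ⟨r, hr, hhalf⟩ := exists_half_abs_le_orbit (n := n + 1) hK hy0 hy hlip hsq hR
    (by omega)
    (by
      refine le_trans ?_ hε1
      gcongr
      linarith)
    (by
      intro r hr
      refine le_trans ?_ (one_div_Bn_le hc r)
      rw [le_div_iff₀ (by linarith [hB1 r])]
      calc 8 * K ^ (k + 1) * |y (k + 1)| ^ 2 * Bn g c r
          ≤ 8 * K ^ (k + 1) * |y (k + 1)| ^ 2 * (U * Bn g c k) := by
            gcongr
            exact hBle r k (by omega)
        _ = 8 * U * K ^ (k + 1) * |y (k + 1)| ^ 2 * Bn g c k := by ring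
        _ ≤ 1 := hε2)
    (by omega)
  refine le_trans ?_ hhalf
  have hBr := le_mul_rpow_of_pow_le (by omega) (hB1 r) (by linarith [hB1 n]) hU
    (hBpow r n (by omega))
  have hBn := one_div_Bn_le hc r
  have hBr1 := hB1 r
  have hneg : (Bn g c n : ℝ) ^ (-1 + 1 / (d : ℝ)) =
      ((Bn g c n : ℝ) ^ (1 - 1 / (d : ℝ)))⁻¹ := by
    rw [← Real.rpow_neg (by linarith [hB1 n])]
    congr 1
    ring
  calc 1 / (2 * U) * (Bn g c n : ℝ) ^ (-1 + 1 / (d : ℝ))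
      = 1 / (U * (Bn g c n : ℝ) ^ (1 - 1 / (d : ℝ))) / 2 := by
        rw [hneg]; field_simp
    _ ≤ 1 / (Bn g c r : ℝ) / 2 := by gcongr
    _ ≤ _ := by gcongr

/-- Proposition 2.17: for `g` `x²`-divisible of degree `d ≥ 3` and
`α ∈ [−4L_g, 4L_g]` with `g ≠ u_d x^d` or `α ≠ 0`, there are `0 < δ < L_g`, `C > 0`
and an integer `N ≥ 0` such that for every `c ∈ (α−δ, α+δ) ∩ S_g`, if `B̂_{n'} ≥ 2`
for some `n' ≥ 0`, then there is a finite set `S_c ⊆ ℕ` of cardinality at most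
`N + n'` such that for every `n ∉ S_c`,
`ln |g_c^n(c)| ≥ min{(−1 + 1/d) ln B_n + ln C, ln δ}`. -/
theorem log_iterate_lower_bound_near_alpha (g : ℤ[X]) (hg : IsX2Divisible g)
    (hd : 3 ≤ g.natDegree) (α : ℝ) (hα : α ∈ Set.Icc (-(4 * Lg g)) (4 * Lg g))
    (hne : g ≠ Polynomial.C g.leadingCoeff * Polynomial.X ^ g.natDegree ∨ α ≠ 0) :
    ∃ δ C : ℝ, ∃ N : ℕ, 0 < δ ∧ δ < Lg g ∧ 0 < C ∧
      ∀ c : ℚ, (c : ℝ) ∈ Set.Ioo (α - δ) (α + δ) → c ∈ Sg g →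
        ∀ n' : ℕ, 2 ≤ hatB g (Bn g c n') →
          ∃ S : Finset ℕ, S.card ≤ N + n' ∧
            ∀ n : ℕ, n ∉ S →
              min ((-1 + 1 / (g.natDegree : ℝ)) * Real.log (Bn g c n) + Real.log C)
                  (Real.log δ) ≤
                Real.log |(gcIter g c (n + 1) : ℝ)| := by
  have hL : 1 ≤ Lg g := by
    have : 0 ≤ ∑ i ∈ Finset.Ico 2 g.natDegree, (|g.coeff i| : ℝ) / (|g.leadingCoeff| : ℝ) :=
      Finset.sum_nonneg fun i _ => by positivity
    unfold Lg
    linarith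
  obtain ⟨C, hC, N, hN⟩ := exists_at_most_one_small_iterate g hg hd (5 * Lg g) (Lg g / 2)
  refine ⟨Lg g / 2, C, N + 1, by linarith, by linarith, hC, ?_⟩
  intro c hcα hc n' _
  have hcD : |(c : ℝ)| ≤ 5 * Lg g := by
    rw [abs_le]
    exact ⟨by linarith [hcα.1, hα.1], by linarith [hcα.2, hα.2]⟩
  have hB : ∀ n, (0 : ℝ) < Bn g c n := fun n => by exact_mod_cast Nat.pos_of_ne_zero (Bn_ne_zero n)
  have hx : ∀ n, 0 < |(gcIter g c (n + 1) : ℝ)| := fun n =>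
    (one_div_pos.2 (hB n)).trans_le (one_div_Bn_le hc n)
  have hlog : ∀ n, (-1 + 1 / (g.natDegree : ℝ)) * Real.log (Bn g c n) + Real.log C =
      Real.log (C * (Bn g c n : ℝ) ^ (-1 + 1 / (g.natDegree : ℝ))) := fun n => by
    rw [Real.log_mul hC.ne' (Real.rpow_pos_of_pos (hB n) _).ne', Real.log_rpow (hB n), add_comm]
  have hTpos : ∀ n, 0 < C * (Bn g c n : ℝ) ^ (-1 + 1 / (g.natDegree : ℝ)) := fun n =>
    mul_pos hC (Real.rpow_pos_of_pos (hB n) _)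
  have hsmall : ∀ n, Real.log |(gcIter g c (n + 1) : ℝ)| <
        min ((-1 + 1 / (g.natDegree : ℝ)) * Real.log (Bn g c n) + Real.log C)
          (Real.log (Lg g / 2)) →
      |(gcIter g c (n + 1) : ℝ)| < C * (Bn g c n : ℝ) ^ (-1 + 1 / (g.natDegree : ℝ)) ∧
        |(gcIter g c (n + 1) : ℝ)| < Lg g / 2 := fun n h => by
    rw [lt_min_iff, hlog, Real.log_lt_log_iff (hx n) (hTpos n),
      Real.log_lt_log_iff (hx n) (by linarith)] at h
    exact h
  by_cases hex : ∃ k, N ≤ k ∧ Real.log |(gcIter g c (k + 1) : ℝ)| <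
      min ((-1 + 1 / (g.natDegree : ℝ)) * Real.log (Bn g c k) + Real.log C)
        (Real.log (Lg g / 2))
  · classical
    obtain ⟨hkN, hk⟩ := Nat.find_spec hex
    refine ⟨insert (Nat.find hex) (Finset.range N), ?_, fun n hn => ?_⟩
    · refine (Finset.card_insert_le _ _).trans ?_
      rw [Finset.card_range]
      omega
    · rw [Finset.mem_insert, Finset.mem_range, not_or, not_lt] at hn
      by_contra! h
      have hlt : Nat.find hex < n := lt_of_le_of_ne (Nat.find_min' hex ⟨hn.2, h⟩) (Ne.symm hn.1)
      obtain ⟨h1, h2⟩ := hsmall _ hk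
      exact (hN c hc hcD _ n hkN hlt h1 h2).not_gt (hsmall n h).1
  · push Not at hex
    refine ⟨Finset.range N, by rw [Finset.card_range]; omega, fun n hn => hex n ?_⟩
    simpa using hn
end

section
/- Every x²-divisible polynomial g ∈ ℤ[x] of degree d ≥ 3 has rapidly increasing numerators on the set of rational numbers c with |c| ≥ 4L_g (this set is contained in S_g). -/
open Polynomial

namespace X2Divisible

lemma eval_add_const (g : ℤ[X]) (c x : ℚ) :
    (g.map (Int.castRingHom ℚ)).eval x + c =
      ∑ i ∈ Finset.range g.natDegree, (g.coeff i : ℚ) * x ^ i +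
        (g.leadingCoeff : ℚ) * x ^ g.natDegree + c := by
  rw [eval_map, eval₂_eq_sum_range, Finset.sum_range_succ]
  simp only [eq_intCast, coeff_natDegree]

lemma gcIter_succ (g : ℤ[X]) (c : ℚ) (n : ℕ) :
    gcIter g c (n + 1) =
      ∑ i ∈ Finset.range g.natDegree, (g.coeff i : ℚ) * gcIter g c n ^ i +
        (g.leadingCoeff : ℚ) * gcIter g c n ^ g.natDegree + c := by
  rw [← eval_add_const, gcIter, Function.iterate_succ_apply', gcIter]

lemma gcIter_one {g : ℤ[X]} (hg : IsX2Divisible g) (c : ℚ) : gcIter g c 1 = c := by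
  have h : (g.map (Int.castRingHom ℚ)).eval 0 = 0 := by
    rw [← coeff_zero_eq_eval_zero, coeff_map, hg.2.1]; simp
  simp [gcIter, h]

lemma leadingCoeff_ne_zero_of_isX2Divisible {g : ℤ[X]} (hg : IsX2Divisible g) : g.leadingCoeff ≠ 0 := by
  rw [leadingCoeff_ne_zero]
  rintro rfl
  simp [IsX2Divisible] at hg

lemma one_le_abs_leadingCoeff {g : ℤ[X]} (hg : IsX2Divisible g) :
    (1 : ℝ) ≤ |(g.leadingCoeff : ℝ)| := by
  exact_mod_cast Int.one_le_abs (leadingCoeff_ne_zero_of_isX2Divisible hg)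

lemma one_le_Lg (g : ℤ[X]) : 1 ≤ Lg g :=
  le_add_of_nonneg_right (Finset.sum_nonneg fun _ _ => by positivity)

/-- The terms of degree less than `d` are dominated by a quarter of the leading term. -/
lemma abs_sum_lower_le {g : ℤ[X]} (hg : IsX2Divisible g) {x : ℝ} (hx : 4 * Lg g ≤ |x|) :
    |∑ i ∈ Finset.range g.natDegree, (g.coeff i : ℝ) * x ^ i| ≤
      |(g.leadingCoeff : ℝ)| * |x| ^ g.natDegree / 4 := by
  have hu := one_le_abs_leadingCoeff hg
  have hL := one_le_Lg g
  have hx1 : 1 ≤ |x| := by linarith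
  have hsub : ∑ i ∈ Finset.range g.natDegree, (g.coeff i : ℝ) * x ^ i =
      ∑ i ∈ Finset.Ico 2 g.natDegree, (g.coeff i : ℝ) * x ^ i := by
    rw [← Finset.sum_range_add_sum_Ico _ hg.1, Finset.sum_range_succ, Finset.sum_range_one,
      hg.2.1, hg.2.2]
    simp
  have hdeg : |x| ^ g.natDegree = |x| ^ (g.natDegree - 1) * |x| := by
    rw [← pow_succ, Nat.sub_add_cancel (by linarith [hg.1])]
  calc |∑ i ∈ Finset.range g.natDegree, (g.coeff i : ℝ) * x ^ i|
      ≤ ∑ i ∈ Finset.Ico 2 g.natDegree, |(g.coeff i : ℝ) * x ^ i| := by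
        rw [hsub]; exact Finset.abs_sum_le_sum_abs _ _
    _ ≤ ∑ i ∈ Finset.Ico 2 g.natDegree, |(g.leadingCoeff : ℝ)| * |x| ^ (g.natDegree - 1) *
          ((|g.coeff i| : ℝ) / (|g.leadingCoeff| : ℝ)) := by
        refine Finset.sum_le_sum fun i hi => ?_
        have hi' : i ≤ g.natDegree - 1 := by
          have := (Finset.mem_Ico.1 hi).2
          omega
        rw [abs_mul, abs_pow]
        have : |(g.leadingCoeff : ℝ)| * |x| ^ (g.natDegree - 1) *
            ((|g.coeff i| : ℝ) / (|g.leadingCoeff| : ℝ)) =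
            |(g.coeff i : ℝ)| * |x| ^ (g.natDegree - 1) := by
          field_simp
        rw [this]
        gcongr
    _ = |(g.leadingCoeff : ℝ)| * |x| ^ (g.natDegree - 1) * (Lg g - 1) := by
        rw [← Finset.mul_sum, Lg, add_sub_cancel_left]
    _ ≤ |(g.leadingCoeff : ℝ)| * |x| ^ (g.natDegree - 1) * (|x| / 4) := by
        gcongr
        linarith
    _ = |(g.leadingCoeff : ℝ)| * |x| ^ g.natDegree / 4 := by
        rw [hdeg]; ring

lemma abs_gcIter_succ_bounds {g : ℤ[X]} (hg : IsX2Divisible g) (hd : 3 ≤ g.natDegree) {c : ℚ}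
    (hc : 4 * Lg g ≤ |(c : ℝ)|) {n : ℕ} (hn : |(c : ℝ)| ≤ |(gcIter g c n : ℝ)|) :
    |(g.leadingCoeff : ℝ)| * |(gcIter g c n : ℝ)| ^ g.natDegree / 2 ≤
        |(gcIter g c (n + 1) : ℝ)| ∧
      |(gcIter g c (n + 1) : ℝ)| ≤
        2 * |(g.leadingCoeff : ℝ)| * |(gcIter g c n : ℝ)| ^ g.natDegree := by
  have hu := one_le_abs_leadingCoeff hg
  have hL := one_le_Lg g
  have hs := abs_sum_lower_le hg (hc.trans hn)
  have hsucc : (gcIter g c (n + 1) : ℝ) =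
      ∑ i ∈ Finset.range g.natDegree, (g.coeff i : ℝ) * (gcIter g c n : ℝ) ^ i +
        (g.leadingCoeff : ℝ) * (gcIter g c n : ℝ) ^ g.natDegree + c := by
    rw [gcIter_succ]; push_cast; rfl
  set x : ℝ := (gcIter g c n : ℝ)
  have hx4 : 4 ≤ |x| := by linarith
  have hpow : 4 * |x| ≤ |x| ^ g.natDegree := by
    calc 4 * |x| ≤ |x| ^ 2 := by nlinarith
      _ ≤ |x| ^ g.natDegree := pow_le_pow_right₀ (by linarith) (by omega)
  have hlead : |(g.leadingCoeff : ℝ) * x ^ g.natDegree| =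
      |(g.leadingCoeff : ℝ)| * |x| ^ g.natDegree := by rw [abs_mul, abs_pow]
  have hclead : |(c : ℝ)| ≤ |(g.leadingCoeff : ℝ)| * |x| ^ g.natDegree / 4 := by
    nlinarith [pow_nonneg (abs_nonneg x) g.natDegree]
  have hl0 : 0 ≤ |(g.leadingCoeff : ℝ)| * |x| ^ g.natDegree := by positivity
  rw [hsucc]
  rw [← hlead] at hs hclead hl0
  generalize (g.leadingCoeff : ℝ) * x ^ g.natDegree = l at *
  generalize ∑ i ∈ Finset.range g.natDegree, (g.coeff i : ℝ) * x ^ i = s at *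
  rw [mul_assoc, ← hlead]
  constructor
  · have h1 : |l| ≤ |s + l + c| + |s| + |(c : ℝ)| := by
      calc |l| = |(s + l + c) - s - c| := by ring_nf
        _ ≤ |s + l + c| + |s| + |(c : ℝ)| :=
          (abs_sub _ _).trans (add_le_add_left (abs_sub _ _) _)
    linarith
  · have h1 : |s + l + c| ≤ |s| + |l| + |(c : ℝ)| := abs_add_three _ _ _
    linarith

/-- Archimedean growth of the critical orbit. -/
lemma abs_gcIter_growth {g : ℤ[X]} (hg : IsX2Divisible g) (hd : 3 ≤ g.natDegree) {c : ℚ}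
    (hc : 4 * Lg g ≤ |(c : ℝ)|) {n : ℕ} (hn : |(c : ℝ)| ≤ |(gcIter g c n : ℝ)|) :
    2 * |(gcIter g c n : ℝ)| ^ (g.natDegree - 1) ≤ |(gcIter g c (n + 1) : ℝ)| ∧
      2 * |(gcIter g c n : ℝ)| ≤ |(gcIter g c (n + 1) : ℝ)| := by
  have hu := one_le_abs_leadingCoeff hg
  have hL := one_le_Lg g
  have hb := (abs_gcIter_succ_bounds hg hd hc hn).1
  set x : ℝ := (gcIter g c n : ℝ)
  have hx4 : 4 ≤ |x| := by linarith
  have hdeg : |x| ^ g.natDegree = |x| ^ (g.natDegree - 1) * |x| := by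
    rw [← pow_succ, Nat.sub_add_cancel (by omega)]
  have hp : 0 < |x| ^ (g.natDegree - 1) := by positivity
  have h1 : 2 * |x| ^ (g.natDegree - 1) ≤ |(gcIter g c (n + 1) : ℝ)| := by
    refine le_trans ?_ hb
    rw [hdeg]
    nlinarith [mul_le_mul_of_nonneg_left hx4 hp.le, mul_pos hp (by linarith : 0 < |x|)]
  refine ⟨h1, le_trans ?_ h1⟩
  have := le_self_pow₀ (by linarith : 1 ≤ |x|) (by omega : g.natDegree - 1 ≠ 0)
  linarith

lemma abs_le_abs_gcIter {g : ℤ[X]} (hg : IsX2Divisible g) (hd : 3 ≤ g.natDegree) {c : ℚ}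
    (hc : 4 * Lg g ≤ |(c : ℝ)|) (n : ℕ) : |(c : ℝ)| ≤ |(gcIter g c (n + 1) : ℝ)| := by
  induction n with
  | zero => simp [gcIter_one hg]
  | succ n ih =>
    have := (abs_gcIter_growth hg hd hc ih).2
    linarith [abs_nonneg (gcIter g c (n + 1) : ℝ)]

lemma pow_le_abs_gcIter {g : ℤ[X]} (hg : IsX2Divisible g) (hd : 3 ≤ g.natDegree) {c : ℚ}
    (hc : 4 * Lg g ≤ |(c : ℝ)|) (n : ℕ) :
    |(c : ℝ)| ^ (g.natDegree - 1) ^ n ≤ |(gcIter g c (n + 1) : ℝ)| := by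
  induction n with
  | zero => simp [gcIter_one hg]
  | succ n ih =>
    have h1 := (abs_gcIter_growth hg hd hc (abs_le_abs_gcIter hg hd hc n)).1
    have h2 := pow_le_pow_left₀ (by positivity) ih (g.natDegree - 1)
    rw [← pow_mul, ← pow_succ] at h2
    have h3 : 0 ≤ |(gcIter g c (n + 1) : ℝ)| ^ (g.natDegree - 1) := by positivity
    linarith

lemma abs_gcIter_le_pow {g : ℤ[X]} (hg : IsX2Divisible g) (hd : 3 ≤ g.natDegree) {c : ℚ}
    (hc : 4 * Lg g ≤ |(c : ℝ)|) (n : ℕ) :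
    |(gcIter g c (n + 1) : ℝ)| ≤
      (2 * |(g.leadingCoeff : ℝ)| * |(c : ℝ)|) ^ g.natDegree ^ n := by
  have hu := one_le_abs_leadingCoeff hg
  suffices h : 2 * |(g.leadingCoeff : ℝ)| * |(gcIter g c (n + 1) : ℝ)| ≤
      (2 * |(g.leadingCoeff : ℝ)| * |(c : ℝ)|) ^ g.natDegree ^ n by
    refine le_trans ?_ h
    nlinarith [abs_nonneg (gcIter g c (n + 1) : ℝ)]
  induction n with
  | zero => simp [gcIter_one hg]
  | succ n ih =>
    have h1 := (abs_gcIter_succ_bounds hg hd hc (abs_le_abs_gcIter hg hd hc n)).2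
    have h2 : (2 * |(g.leadingCoeff : ℝ)|) ^ 2 ≤ (2 * |(g.leadingCoeff : ℝ)|) ^ g.natDegree :=
      pow_le_pow_right₀ (by linarith) (by omega)
    calc 2 * |(g.leadingCoeff : ℝ)| * |(gcIter g c (n + 1 + 1) : ℝ)|
        ≤ 2 * |(g.leadingCoeff : ℝ)| *
          (2 * |(g.leadingCoeff : ℝ)| * |(gcIter g c (n + 1) : ℝ)| ^ g.natDegree) := by gcongr
      _ = (2 * |(g.leadingCoeff : ℝ)|) ^ 2 * |(gcIter g c (n + 1) : ℝ)| ^ g.natDegree := by ring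
      _ ≤ (2 * |(g.leadingCoeff : ℝ)|) ^ g.natDegree *
          |(gcIter g c (n + 1) : ℝ)| ^ g.natDegree := by gcongr
      _ = (2 * |(g.leadingCoeff : ℝ)| * |(gcIter g c (n + 1) : ℝ)|) ^ g.natDegree := by
          rw [← mul_pow]
      _ ≤ ((2 * |(g.leadingCoeff : ℝ)| * |(c : ℝ)|) ^ g.natDegree ^ n) ^ g.natDegree := by gcongr
      _ = (2 * |(g.leadingCoeff : ℝ)| * |(c : ℝ)|) ^ g.natDegree ^ (n + 1) := by
          rw [← pow_mul, ← pow_succ]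

lemma mem_Sg {g : ℤ[X]} (hg : IsX2Divisible g) (hd : 3 ≤ g.natDegree) {c : ℚ}
    (hc : 4 * Lg g ≤ |(c : ℝ)|) : c ∈ Sg g := by
  have hmono : StrictMono fun n : ℕ => |(gcIter g c (n + 1) : ℝ)| := by
    refine strictMono_nat_of_lt_succ fun n => ?_
    have h1 := abs_le_abs_gcIter hg hd hc n
    have h2 := (abs_gcIter_growth hg hd hc h1).2
    have hL := one_le_Lg g
    linarith
  refine Set.infinite_range_of_injective fun m n hmn => hmono.injective ?_
  simp only [hmn]

/-- The denominator of `g_c^n(c)` divides `B_0 ^ d ^ n`. -/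
lemma den_gcIter_dvd {g : ℤ[X]} (hg : IsX2Divisible g) (c : ℚ) (n : ℕ) :
    (gcIter g c (n + 1)).den ∣ c.den ^ g.natDegree ^ n := by
  suffices h : ∃ z : ℤ, gcIter g c (n + 1) * ((c.den ^ g.natDegree ^ n : ℕ) : ℚ) = z by
    obtain ⟨z, hz⟩ := h
    have hne : ((c.den ^ g.natDegree ^ n : ℕ) : ℚ) ≠ 0 := by
      exact_mod_cast pow_ne_zero _ c.den_nz
    have hq : gcIter g c (n + 1) = Rat.divInt z ((c.den ^ g.natDegree ^ n : ℕ) : ℤ) := by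
      rw [Rat.divInt_eq_div, ← hz, Int.cast_natCast, mul_div_cancel_right₀ _ hne]
    have := Rat.den_dvd z ((c.den ^ g.natDegree ^ n : ℕ) : ℤ)
    rw [← hq] at this
    exact_mod_cast this
  induction n with
  | zero => exact ⟨c.num, by simp [gcIter_one hg, Rat.mul_den_eq_num]⟩
  | succ n ih =>
    obtain ⟨z, hz⟩ := ih
    have hpow : c.den ^ g.natDegree ^ (n + 1) = (c.den ^ g.natDegree ^ n) ^ g.natDegree := by
      rw [← pow_mul, ← pow_succ]
    have hdvd : c.den ∣ (c.den ^ g.natDegree ^ n) ^ g.natDegree := by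
      rw [← pow_mul]
      exact dvd_pow_self _ (mul_ne_zero (pow_ne_zero _ (by linarith [hg.1])) (by linarith [hg.1]))
    obtain ⟨k, hk⟩ := hdvd
    rw [hpow]
    have hcz : c * (((c.den ^ g.natDegree ^ n) ^ g.natDegree : ℕ) : ℚ) = ((c.num * k : ℤ) : ℚ) := by
      rw [hk]
      push_cast
      rw [← mul_assoc, Rat.mul_den_eq_num]
    generalize c.den ^ g.natDegree ^ n = D at *
    refine ⟨∑ i ∈ Finset.range g.natDegree, g.coeff i * z ^ i * (D : ℤ) ^ (g.natDegree - i) +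
      g.leadingCoeff * z ^ g.natDegree + c.num * k, ?_⟩
    rw [gcIter_succ, add_mul, hcz, add_mul, Finset.sum_mul]
    push_cast
    congr 2
    · refine Finset.sum_congr rfl fun i hi => ?_
      have hi' : i ≤ g.natDegree := (Finset.mem_range.1 hi).le
      rw [← hz, mul_pow, ← Nat.add_sub_of_le hi', pow_add]
      simp only [Nat.add_sub_cancel_left]
      ring
    · rw [← hz, mul_pow, mul_assoc]

/-- Nonarchimedean growth of the critical orbit at primes dividing `B_0` more than `u_d`. -/
lemma padicNorm_gcIter_growth {g : ℤ[X]} (hg : IsX2Divisible g) {c : ℚ} {p : ℕ}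
    [Fact p.Prime] (hp : 1 < padicNorm p g.leadingCoeff * padicNorm p c) (n : ℕ) :
    padicNorm p c ^ (g.natDegree - 1) ^ n ≤ padicNorm p (gcIter g c (n + 1)) := by
  have hu := padicNorm.of_int (p := p) g.leadingCoeff
  have hc1 : 1 < padicNorm p c := by
    have := padicNorm.nonneg (p := p) c
    nlinarith
  have hd1 : 1 ≤ g.natDegree - 1 := by have := hg.1; omega
  suffices h : padicNorm p c ≤ padicNorm p (gcIter g c (n + 1)) ∧
      padicNorm p c ^ (g.natDegree - 1) ^ n ≤ padicNorm p (gcIter g c (n + 1)) from h.2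
  induction n with
  | zero => simp [gcIter_one hg]
  | succ n ih =>
    obtain ⟨ih1, ih2⟩ := ih
    have hsucc := gcIter_succ g c (n + 1)
    set x := gcIter g c (n + 1)
    have hx1 : 1 < padicNorm p x := by linarith
    have hpow : padicNorm p (x ^ g.natDegree) = padicNorm p x ^ g.natDegree :=
      IsAbsoluteValue.abv_pow (padicNorm p) _ _
    have hlow : padicNorm p (∑ i ∈ Finset.range g.natDegree, (g.coeff i : ℚ) * x ^ i + c) ≤
        padicNorm p x ^ (g.natDegree - 1) := by
      refine padicNorm.nonarchimedean.trans (max_le ?_ ?_)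
      · refine padicNorm.sum_le' (fun i hi => ?_) (by positivity)
        have hi' : i ≤ g.natDegree - 1 := by
          have := Finset.mem_range.1 hi
          omega
        have hxi : padicNorm p (x ^ i) = padicNorm p x ^ i := IsAbsoluteValue.abv_pow (padicNorm p) _ _
        rw [padicNorm.mul, hxi]
        calc padicNorm p (g.coeff i) * padicNorm p x ^ i ≤ 1 * padicNorm p x ^ i := by
              gcongr
              exact padicNorm.of_int _
          _ ≤ padicNorm p x ^ (g.natDegree - 1) := by
              rw [one_mul]; exact pow_le_pow_right₀ hx1.le hi'
      · exact ih1.trans (le_self_pow₀ hx1.le (by omega))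
    have hlead : padicNorm p x ^ (g.natDegree - 1) <
        padicNorm p (g.leadingCoeff * x ^ g.natDegree) := by
      rw [padicNorm.mul, hpow]
      have hdeg : padicNorm p x ^ g.natDegree =
          padicNorm p x ^ (g.natDegree - 1) * padicNorm p x := by
        rw [← pow_succ, Nat.sub_add_cancel (by omega)]
      rw [hdeg]
      have h1 : 1 < padicNorm p g.leadingCoeff * padicNorm p x :=
        hp.trans_le (mul_le_mul_of_nonneg_left ih1 (padicNorm.nonneg _))
      have h2 : 0 < padicNorm p x ^ (g.natDegree - 1) := by positivity
      nlinarith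
    have hnorm : padicNorm p x ^ (g.natDegree - 1) ≤ padicNorm p (gcIter g c (n + 1 + 1)) := by
      rw [hsucc, add_right_comm, padicNorm.add_eq_max_of_ne (hlow.trans_lt hlead).ne]
      exact hlead.le.trans (le_max_right _ _)
    constructor
    · exact (ih1.trans (le_self_pow₀ hx1.le (by omega))).trans hnorm
    · refine le_trans ?_ hnorm
      rw [pow_succ, pow_mul]
      gcongr

lemma pow_dvd_den_of_le_padicNorm {p : ℕ} [Fact p.Prime] {x : ℚ} {k : ℕ}
    (hx : (p : ℚ) ^ k ≤ padicNorm p x) : p ^ k ∣ x.den := by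
  have hp0 : (0 : ℚ) < p := by exact_mod_cast (Fact.out : p.Prime).pos
  have h : ((p ^ k : ℕ) : ℤ) ∣ (x.den : ℤ) := by
    rw [padicNorm.dvd_iff_norm_le, zpow_neg, zpow_natCast, ← one_div, le_div_iff₀ (by positivity)]
    calc padicNorm p ((x.den : ℤ) : ℚ) * (p : ℚ) ^ k
        ≤ padicNorm p ((x.den : ℤ) : ℚ) * padicNorm p x :=
          mul_le_mul_of_nonneg_left hx (padicNorm.nonneg _)
      _ = padicNorm p (x.num : ℚ) := by
          rw [mul_comm, ← padicNorm.mul, Int.cast_natCast, Rat.mul_den_eq_num]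
      _ ≤ 1 := padicNorm.of_int _
  exact_mod_cast h

lemma padicNorm_of_dvd_den {p : ℕ} [Fact p.Prime] {x : ℚ} (hx : p ∣ x.den) :
    padicNorm p x = (p : ℚ) ^ padicValNat p x.den := by
  have hp0 : (p : ℚ) ≠ 0 := by exact_mod_cast (Fact.out : p.Prime).ne_zero
  have hnum : padicNorm p (x.num : ℚ) = 1 := by
    rw [padicNorm.int_eq_one_iff]
    intro h
    have := Nat.dvd_gcd (Int.natCast_dvd.1 h) hx
    rw [x.reduced.gcd_eq_one] at this
    exact (Fact.out : p.Prime).one_lt.ne' (Nat.dvd_one.1 this)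
  have hden : padicNorm p (x.den : ℚ) = ((p : ℚ) ^ padicValNat p x.den)⁻¹ := by
    rw [padicNorm.eq_zpow_of_nonzero (by exact_mod_cast x.den_nz), padicValRat.of_nat, zpow_neg,
      zpow_natCast]
  have h := congrArg (padicNorm p) (Rat.mul_den_eq_num x)
  rw [padicNorm.mul, hnum, hden] at h
  field_simp at h
  exact h

lemma hatB_pow_dvd_den {g : ℤ[X]} (hg : IsX2Divisible g) (c : ℚ) (n : ℕ) :
    hatB g c.den ^ (g.natDegree - 1) ^ n ∣ (gcIter g c (n + 1)).den := by
  rw [hatB, ← Finset.prod_pow]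
  refine Finset.prod_dvd_of_isRelPrime ?_ fun p hp => ?_
  · intro p hp q hq hpq
    simp only [Finset.coe_filter, Set.mem_ofPred_eq] at hp hq
    rw [Function.onFun, ← Nat.coprime_iff_isRelPrime, ← pow_mul, ← pow_mul]
    exact Nat.Coprime.pow _ _ ((Nat.coprime_primes (Nat.prime_of_mem_primeFactors hp.1)
      (Nat.prime_of_mem_primeFactors hq.1)).2 hpq)
  · rw [Finset.mem_filter] at hp
    have : Fact p.Prime := ⟨Nat.prime_of_mem_primeFactors hp.1⟩
    have hp1 : (1 : ℚ) < p := by exact_mod_cast (Fact.out : p.Prime).one_lt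
    have hc := padicNorm_of_dvd_den (Nat.dvd_of_mem_primeFactors hp.1)
    rw [← pow_mul]
    refine pow_dvd_den_of_le_padicNorm ?_
    rw [pow_mul, ← hc]
    refine padicNorm_gcIter_growth hg ?_ n
    rw [hc, padicNorm.eq_zpow_of_nonzero (by exact_mod_cast leadingCoeff_ne_zero_of_isX2Divisible hg),
      padicValRat.of_int, zpow_neg, zpow_natCast, ← div_eq_inv_mul, one_lt_div (by positivity)]
    exact pow_lt_pow_right₀ hp1 hp.2

lemma dvd_hatB_mul {g : ℤ[X]} (hg : IsX2Divisible g) {b : ℕ} (hb : b ≠ 0) :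
    b ∣ hatB g b * g.leadingCoeff.natAbs := by
  have hfac : ∏ p ∈ b.primeFactors, p ^ padicValNat p b = b := by
    conv_rhs => rw [← Nat.prod_factorization_pow_eq_self hb]
    rw [Finsupp.prod, Nat.support_factorization]
    refine Finset.prod_congr rfl fun p hp => ?_
    rw [Nat.factorization_def _ (Nat.prime_of_mem_primeFactors hp)]
  conv_lhs => rw [← hfac, ← Finset.prod_filter_mul_prod_filter_not b.primeFactors
    (fun p => padicValInt p g.leadingCoeff < padicValNat p b)]
  refine mul_dvd_mul dvd_rfl (Finset.prod_dvd_of_isRelPrime ?_ fun p hp => ?_)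
  · intro p hp q hq hpq
    simp only [Finset.coe_filter, Set.mem_ofPred_eq] at hp hq
    rw [Function.onFun, ← Nat.coprime_iff_isRelPrime]
    exact Nat.Coprime.pow _ _ ((Nat.coprime_primes (Nat.prime_of_mem_primeFactors hp.1)
      (Nat.prime_of_mem_primeFactors hq.1)).2 hpq)
  · rw [Finset.mem_filter, not_lt] at hp
    have : Fact p.Prime := ⟨Nat.prime_of_mem_primeFactors hp.1⟩
    exact (padicValNat_dvd_iff_le (Int.natAbs_ne_zero.2 (leadingCoeff_ne_zero_of_isX2Divisible hg))).2 hp.2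

lemma abs_An (g : ℤ[X]) (c : ℚ) (n : ℕ) :
    |(An g c n : ℝ)| = |(gcIter g c (n + 1) : ℝ)| * ((gcIter g c (n + 1)).den : ℝ) := by
  have h : ((gcIter g c (n + 1) : ℚ) : ℝ) * ((gcIter g c (n + 1)).den : ℝ) =
      ((gcIter g c (n + 1)).num : ℝ) := by
    exact_mod_cast Rat.mul_den_eq_num (gcIter g c (n + 1))
  rw [An, ← h, abs_mul, Nat.abs_cast]

lemma hatB_pos (g : ℤ[X]) (b : ℕ) : 0 < hatB g b :=
  Finset.prod_pos fun _ hp =>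
    pow_pos (Nat.prime_of_mem_primeFactors (Finset.mem_filter.1 hp).1).pos _

lemma le_log_An {g : ℤ[X]} (hg : IsX2Divisible g) (hd : 3 ≤ g.natDegree) {c : ℚ}
    (hc : 4 * Lg g ≤ |(c : ℝ)|) (n : ℕ) :
    ((g.natDegree - 1 : ℕ) : ℝ) ^ n * (Real.log |(c : ℝ)| + Real.log (hatB g c.den)) ≤
      Real.log |(An g c n : ℝ)| := by
  have hL := one_le_Lg g
  have hH : (0 : ℝ) < hatB g c.den := by exact_mod_cast hatB_pos g c.den
  have hc0 : 0 < |(c : ℝ)| := by linarith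
  have hB : (hatB g c.den : ℝ) ^ (g.natDegree - 1) ^ n ≤ ((gcIter g c (n + 1)).den : ℝ) := by
    exact_mod_cast Nat.le_of_dvd (gcIter g c (n + 1)).den_pos (hatB_pow_dvd_den hg c n)
  have h : (|(c : ℝ)| * hatB g c.den) ^ (g.natDegree - 1) ^ n ≤ |(An g c n : ℝ)| := by
    rw [abs_An, mul_pow]
    exact mul_le_mul (pow_le_abs_gcIter hg hd hc n) hB (by positivity) (abs_nonneg _)
  have hlog := Real.log_le_log (by positivity) h
  rwa [Real.log_pow, Real.log_mul hc0.ne' hH.ne', Nat.cast_pow] at hlog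

lemma one_le_log_abs {g : ℤ[X]} {c : ℚ} (hc : 4 * Lg g ≤ |(c : ℝ)|) :
    1 ≤ Real.log |(c : ℝ)| := by
  have hL := one_le_Lg g
  rw [Real.le_log_iff_exp_le (by linarith)]
  linarith [Real.exp_one_lt_d9]

lemma log_An_le {g : ℤ[X]} (hg : IsX2Divisible g) (hd : 3 ≤ g.natDegree) {c : ℚ}
    (hc : 4 * Lg g ≤ |(c : ℝ)|) (n : ℕ) :
    Real.log |(An g c n : ℝ)| ≤ (g.natDegree : ℝ) ^ n *
      ((1 + Real.log (2 * |(g.leadingCoeff : ℝ)| ^ 2)) *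
        (Real.log |(c : ℝ)| + Real.log (hatB g c.den))) := by
  have hL := one_le_Lg g
  have hu := one_le_abs_leadingCoeff hg
  have hH : (1 : ℝ) ≤ hatB g c.den := by exact_mod_cast hatB_pos g c.den
  have hc0 : 0 < |(c : ℝ)| := by linarith
  have hB0 : (c.den : ℝ) ≤ hatB g c.den * |(g.leadingCoeff : ℝ)| := by
    have := Nat.le_of_dvd (Nat.mul_pos (hatB_pos g c.den)
      (Int.natAbs_pos.2 (leadingCoeff_ne_zero_of_isX2Divisible hg))) (dvd_hatB_mul hg c.den_nz)
    rw [← Int.cast_abs, ← Nat.cast_natAbs]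
    exact_mod_cast this
  have hB : ((gcIter g c (n + 1)).den : ℝ) ≤
      (hatB g c.den * |(g.leadingCoeff : ℝ)|) ^ g.natDegree ^ n := by
    calc ((gcIter g c (n + 1)).den : ℝ) ≤ (c.den : ℝ) ^ g.natDegree ^ n := by
          exact_mod_cast Nat.le_of_dvd (pow_pos c.den_pos _) (den_gcIter_dvd hg c n)
      _ ≤ _ := by gcongr
  have hA0 : 0 < |(An g c n : ℝ)| := by
    rw [abs_An]
    exact mul_pos (hc0.trans_le (abs_le_abs_gcIter hg hd hc n))
      (by exact_mod_cast (gcIter g c (n + 1)).den_pos)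
  have h : |(An g c n : ℝ)| ≤
      (2 * |(g.leadingCoeff : ℝ)| ^ 2 * (|(c : ℝ)| * hatB g c.den)) ^ g.natDegree ^ n := by
    rw [abs_An]
    refine (mul_le_mul (abs_gcIter_le_pow hg hd hc n) hB (by positivity) (by positivity)).trans ?_
    rw [← mul_pow]
    refine le_of_eq ?_
    ring
  have hlog := Real.log_le_log hA0 h
  have hu2 : 0 < 2 * |(g.leadingCoeff : ℝ)| ^ 2 := by positivity
  rw [Real.log_pow, Real.log_mul hu2.ne' (by positivity),
    Real.log_mul hc0.ne' (by positivity), Nat.cast_pow] at hlog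
  refine hlog.trans ?_
  have h1 := one_le_log_abs hc
  have h2 : 0 ≤ Real.log (hatB g c.den) := Real.log_nonneg hH
  have h3 : 0 ≤ Real.log (2 * |(g.leadingCoeff : ℝ)| ^ 2) := Real.log_nonneg (by nlinarith)
  gcongr
  nlinarith

/-- For `d ≥ 3`, `(d - 1) ^ n` eventually dominates `K * n * d ^ (n / 2)`. -/
lemma exists_forall_mul_pow_half_lt {d : ℕ} (hd : 3 ≤ d) {K : ℝ} (hK : 0 < K) :
    ∃ N : ℕ, ∀ n ≥ N, (n : ℝ) * ((d : ℝ) ^ (n / 2) * K) < ((d - 1 : ℕ) : ℝ) ^ n := by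
  have hr : |(d : ℝ) / (d + 1)| < 1 := by
    rw [abs_of_nonneg (by positivity), div_lt_one (by positivity)]
    linarith
  have ht := tendsto_pow_const_mul_const_pow_of_abs_lt_one 2 hr
  obtain ⟨N, hN⟩ := Filter.eventually_atTop.1
    (ht.eventually_lt_const (by positivity : (0 : ℝ) < 1 / K ^ 2))
  refine ⟨N, fun n hn => lt_of_pow_lt_pow_left₀ 2 (by positivity) ?_⟩
  have h := hN n hn
  rw [div_pow, lt_div_iff₀ (by positivity), ← mul_div_assoc, div_mul_eq_mul_div,
    div_lt_one (by positivity)] at h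
  have hd3 : (3 : ℝ) ≤ d := by exact_mod_cast hd
  have hd1 : (1 : ℝ) ≤ d := by linarith
  calc ((n : ℝ) * ((d : ℝ) ^ (n / 2) * K)) ^ 2
      = (n : ℝ) ^ 2 * (d : ℝ) ^ (n / 2 * 2) * K ^ 2 := by rw [pow_mul]; ring
    _ ≤ (n : ℝ) ^ 2 * (d : ℝ) ^ n * K ^ 2 := by
        gcongr
        exact Nat.div_mul_le_self n 2
    _ < ((d : ℝ) + 1) ^ n := h
    _ ≤ (((d - 1 : ℕ) : ℝ) ^ 2) ^ n := by
        gcongr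
        rw [Nat.cast_sub (by omega)]
        push_cast
        nlinarith
    _ = (((d - 1 : ℕ) : ℝ) ^ n) ^ 2 := by rw [← pow_mul, ← pow_mul, mul_comm]

end X2Divisible

open X2Divisible

/-- Proposition 3.3: every `x²`-divisible `g ∈ ℤ[x]` of degree `d ≥ 3` has rapidly
increasing numerators on `{c ∈ ℚ : |c| ≥ 4L_g}`, which is contained in `S_g`. -/
theorem rapidly_increasing_numerators_outside (g : ℤ[X]) (hg : IsX2Divisible g)
    (hd : 3 ≤ g.natDegree) :
    {c : ℚ | 4 * Lg g ≤ |(c : ℝ)|} ⊆ Sg g ∧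
    RapidlyIncreasingNumerators g {c : ℚ | 4 * Lg g ≤ |(c : ℝ)|} := by
  refine ⟨fun c hc => mem_Sg hg hd hc, ?_⟩
  have hu := one_le_abs_leadingCoeff hg
  set K : ℝ := 1 + Real.log (2 * |(g.leadingCoeff : ℝ)| ^ 2) with hKdef
  have hK : 0 < K := by
    have := Real.log_nonneg (by nlinarith : 1 ≤ 2 * |(g.leadingCoeff : ℝ)| ^ 2)
    linarith
  obtain ⟨N, hN⟩ := exists_forall_mul_pow_half_lt hd hK
  refine ⟨N + 1, N.succ_pos, fun c hc => ⟨Finset.range N, by simp, fun n _ hn => ?_⟩⟩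
  have hc' : 4 * Lg g ≤ |(c : ℝ)| := hc
  rw [Finset.mem_range, not_lt] at hn
  set M : ℝ := Real.log |(c : ℝ)| + Real.log (hatB g c.den)
  have hM : 0 < M := by
    have h1 := one_le_log_abs hc'
    have h2 : 0 ≤ Real.log (hatB g c.den) := Real.log_natCast_nonneg _
    exact add_pos_of_pos_of_nonneg (by linarith) h2
  have hd1 : (1 : ℝ) ≤ g.natDegree := by exact_mod_cast (by omega : 1 ≤ g.natDegree)
  have hcard : (n.primeFactors.card : ℝ) ≤ n := by
    have : n.primeFactors ⊆ Finset.Icc 1 n := fun p hp => Finset.mem_Icc.2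
      ⟨(Nat.prime_of_mem_primeFactors hp).one_le, Nat.le_of_mem_primeFactors hp⟩
    exact_mod_cast (Finset.card_le_card this).trans (by simp)
  calc ∑ p ∈ n.primeFactors, Real.log |(An g c (n / p) : ℝ)|
      ≤ ∑ _p ∈ n.primeFactors, (g.natDegree : ℝ) ^ (n / 2) * (K * M) := by
        refine Finset.sum_le_sum fun p hp => (log_An_le hg hd hc' (n / p)).trans ?_
        gcongr
        exact (Nat.prime_of_mem_primeFactors hp).two_le
    _ = n.primeFactors.card * ((g.natDegree : ℝ) ^ (n / 2) * (K * M)) := by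
        rw [Finset.sum_const, nsmul_eq_mul]
    _ ≤ n * ((g.natDegree : ℝ) ^ (n / 2) * (K * M)) := by gcongr
    _ = n * ((g.natDegree : ℝ) ^ (n / 2) * K) * M := by ring
    _ < ((g.natDegree - 1 : ℕ) : ℝ) ^ n * M := mul_lt_mul_of_pos_right (hN n hn) hM
    _ ≤ Real.log |(An g c n : ℝ)| := le_log_An hg hd hc' n
end

section
/- Every polynomial g(x) = u_d x^d ∈ ℤ[x] of degree d ≥ 3 (u_d ≠ 0) has rapidly increasing numerators on (−1/(4|u_d|), 1/(4|u_d|)) ∩ S_g. -/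
open Polynomial

lemma gcIter_monomial_succ (u : ℤ) (d : ℕ) (c : ℚ) (n : ℕ) :
    gcIter (Polynomial.C u * Polynomial.X ^ d) c (n + 1) =
      u * gcIter (Polynomial.C u * Polynomial.X ^ d) c n ^ d + c := by
  simp [gcIter, Function.iterate_succ_apply']

lemma ne_zero_of_mem_Sg_monomial {u : ℤ} {d : ℕ} (hd : d ≠ 0) {c : ℚ}
    (hc : c ∈ Sg (Polynomial.C u * Polynomial.X ^ d)) : c ≠ 0 := by
  rintro rfl
  refine hc ((Set.finite_singleton (0 : ℚ)).subset ?_)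
  rintro _ ⟨n, rfl⟩
  have h : ∀ n, gcIter (Polynomial.C u * Polynomial.X ^ d) 0 n = 0 := by
    intro n
    induction n with
    | zero => rfl
    | succ n ih => rw [gcIter_monomial_succ, ih]; simp [hd]
  exact h _

lemma abs_mul_pow_le_half {u : ℤ} (hu : u ≠ 0) {d : ℕ} (hd : 3 ≤ d) {c x : ℚ}
    (hc : |c| * (4 * |(u : ℚ)|) < 1) (hx : |x| ≤ 2 * |c|) :
    |(u : ℚ) * x ^ d| ≤ |c| / 2 := by
  have hu1 : (1 : ℚ) ≤ |(u : ℚ)| := by exact_mod_cast Int.one_le_abs hu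
  have hc0 := abs_nonneg c
  have hc4 : |c| ≤ 1 / 4 := by nlinarith
  have hx1 : |x| ≤ 1 := by linarith
  have hpow : |x| ^ d ≤ |x| ^ 3 := pow_le_pow_of_le_one (abs_nonneg x) hx1 hd
  have hpow' : |x| ^ 3 ≤ (2 * |c|) ^ 3 := pow_le_pow_left₀ (abs_nonneg x) hx 3
  rw [abs_mul, abs_pow]
  calc |(u : ℚ)| * |x| ^ d ≤ |(u : ℚ)| * (2 * |c|) ^ 3 := by gcongr; exact hpow.trans hpow'
    _ = 2 * |c| ^ 2 * (|c| * (4 * |(u : ℚ)|)) := by ring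
    _ ≤ 2 * |c| ^ 2 * 1 := by gcongr
    _ ≤ |c| / 2 := by nlinarith

/-- The orbit of a small parameter stays within a factor two of that parameter. -/
lemma gcIter_monomial_bounds {u : ℤ} (hu : u ≠ 0) {d : ℕ} (hd : 3 ≤ d) {c : ℚ}
    (hc : |c| * (4 * |(u : ℚ)|) < 1) (n : ℕ) :
    |c| / 2 ≤ |gcIter (Polynomial.C u * Polynomial.X ^ d) c (n + 1)| ∧
      |gcIter (Polynomial.C u * Polynomial.X ^ d) c (n + 1)| ≤ 2 * |c| := by
  have key : ∀ n, |gcIter (Polynomial.C u * Polynomial.X ^ d) c n| ≤ 2 * |c| →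
      |c| / 2 ≤ |gcIter (Polynomial.C u * Polynomial.X ^ d) c (n + 1)| ∧
      |gcIter (Polynomial.C u * Polynomial.X ^ d) c (n + 1)| ≤ 2 * |c| := by
    intro n hn
    have h := abs_mul_pow_le_half hu hd hc hn
    rw [gcIter_monomial_succ]
    set y := (u : ℚ) * gcIter (Polynomial.C u * Polynomial.X ^ d) c n ^ d
    have h1 := abs_add_le y c
    have h2 := abs_sub_abs_le_abs_sub c (-y)
    rw [abs_neg, sub_neg_eq_add, add_comm c y] at h2
    have := abs_nonneg c
    constructor <;> linarith
  induction n with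
  | zero => exact key 0 (by simp [gcIter])
  | succ n ih => exact key _ ih.2

lemma den_pow_le_of_eq_mul_pow_add {u : ℤ} (hu : u ≠ 0) (d : ℕ) {c x y : ℚ}
    (h : y = u * x ^ d + c) : x.den ^ d ≤ u.natAbs * c.den * y.den := by
  have hq : (u * x.num ^ d * c.den * y.den : ℚ) =
      x.den ^ d * (y.num * c.den - c.num * y.den) := by
    rw [← Rat.mul_den_eq_num x, ← Rat.mul_den_eq_num y, ← Rat.mul_den_eq_num c, h, mul_pow]
    ring
  have hz : u * x.num ^ d * c.den * y.den =
      (x.den : ℤ) ^ d * (y.num * c.den - c.num * y.den) := by exact_mod_cast hq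
  have hcop : IsCoprime ((x.den : ℤ) ^ d) (x.num ^ d) :=
    (Rat.isCoprime_num_den x).symm.pow
  have hdvd : (x.den : ℤ) ^ d ∣ u * c.den * y.den := by
    refine hcop.dvd_of_dvd_mul_left ⟨_, (Eq.trans ?_ hz)⟩
    ring
  have hnat := Int.natAbs_dvd_natAbs.mpr hdvd
  simp only [Int.natAbs_mul, Int.natAbs_pow, Int.natAbs_natCast] at hnat
  exact Nat.le_of_dvd
    (Nat.mul_pos (Nat.mul_pos (Int.natAbs_pos.mpr hu) c.den_pos) y.den_pos) hnat

lemma den_gcIter_monomial_dvd (u : ℤ) {d : ℕ} (hd : d ≠ 0) (c : ℚ) (n : ℕ) :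
    (gcIter (Polynomial.C u * Polynomial.X ^ d) c (n + 1)).den ∣ c.den ^ d ^ n := by
  induction n with
  | zero => rw [gcIter_monomial_succ]; simp [gcIter, hd]
  | succ n ih =>
    rw [gcIter_monomial_succ]
    refine (Rat.add_den_dvd_lcm _ _).trans (Nat.lcm_dvd ?_ ?_)
    · refine (Rat.mul_den_dvd _ _).trans ?_
      rw [Rat.den_intCast, one_mul, Rat.den_pow, pow_succ d n, pow_mul]
      exact pow_dvd_pow_of_dvd ih d
    · exact dvd_pow_self _ (pow_ne_zero _ hd)

lemma log_den_gcIter_monomial_ge {u : ℤ} (hu : u ≠ 0) {d : ℕ} (hd : 3 ≤ d) (c : ℚ) (n : ℕ) :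
    (d : ℝ) ^ n * ((Real.log c.den - Real.log u.natAbs) / 2) +
        (Real.log c.den + Real.log u.natAbs) / 2 ≤
      Real.log (gcIter (Polynomial.C u * Polynomial.X ^ d) c (n + 1)).den := by
  induction n with
  | zero => rw [gcIter_monomial_succ]; simp [gcIter, show d ≠ 0 by omega]; linarith
  | succ n ih =>
    have h := den_pow_le_of_eq_mul_pow_add hu d
      (gcIter_monomial_succ u d c (n + 1))
    set x := gcIter (Polynomial.C u * Polynomial.X ^ d) c (n + 1)
    set y := gcIter (Polynomial.C u * Polynomial.X ^ d) c (n + 1 + 1)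
    have hx : (0 : ℝ) < x.den := by exact_mod_cast x.den_pos
    have hy : (y.den : ℝ) ≠ 0 := by exact_mod_cast y.den_nz
    have hc : (c.den : ℝ) ≠ 0 := by exact_mod_cast c.den_nz
    have hu' : (u.natAbs : ℝ) ≠ 0 := by exact_mod_cast Int.natAbs_ne_zero.mpr hu
    have h' : (x.den : ℝ) ^ d ≤ u.natAbs * c.den * y.den := by exact_mod_cast h
    have hlog := Real.log_le_log (pow_pos hx d) h'
    rw [Real.log_pow, Real.log_mul (mul_ne_zero hu' hc) hy, Real.log_mul hu' hc] at hlog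
    have hd' : (3 : ℝ) ≤ d := by exact_mod_cast hd
    have hnn : 0 ≤ Real.log c.den + Real.log u.natAbs :=
      add_nonneg (Real.log_natCast_nonneg _) (Real.log_natCast_nonneg _)
    rw [pow_succ]
    nlinarith [mul_le_mul_of_nonneg_left ih (by linarith : (0 : ℝ) ≤ d),
      mul_nonneg (sub_nonneg.mpr hd') hnn]

lemma sq_succ_le_four_mul_three_pow (m : ℕ) : (m + 1) ^ 2 ≤ 4 * 3 ^ m := by
  induction m with
  | zero => norm_num
  | succ m ih =>
    rcases m with _ | m
    · norm_num
    · rw [pow_succ 3 (m + 1)]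
      generalize 3 ^ (m + 1) = T at *
      nlinarith [Nat.zero_le m, Nat.zero_le (m * m)]

lemma sum_primeFactors_pow_div_le {d : ℕ} (hd : 0 < d) (n : ℕ) :
    ∑ p ∈ n.primeFactors, d ^ (n / p) ≤ n * d ^ (n / 2) := by
  have hcard : n.primeFactors.card ≤ n := by
    have hsub : n.primeFactors ⊆ Finset.Icc 1 n := fun p hp =>
      Finset.mem_Icc.mpr ⟨(Nat.prime_of_mem_primeFactors hp).one_le, Nat.le_of_mem_primeFactors hp⟩
    simpa using Finset.card_le_card hsub
  calc ∑ p ∈ n.primeFactors, d ^ (n / p) ≤ ∑ _p ∈ n.primeFactors, d ^ (n / 2) := by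
        refine Finset.sum_le_sum fun p hp => Nat.pow_le_pow_right hd ?_
        exact Nat.div_le_div_left (Nat.prime_of_mem_primeFactors hp).two_le (by norm_num)
    _ = n.primeFactors.card * d ^ (n / 2) := by simp
    _ ≤ n * d ^ (n / 2) := Nat.mul_le_mul_right _ hcard

lemma exists_forall_sum_primeFactors_pow_lt {d : ℕ} (hd : 3 ≤ d) {κ : ℝ} (hκ : 0 < κ) :
    ∃ N : ℕ, ∀ n, N ≤ n →
      ∑ p ∈ n.primeFactors, (d : ℝ) ^ (n / p) + 2 < κ * (d : ℝ) ^ n := by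
  obtain ⟨M, hM⟩ := exists_nat_gt (12 / κ)
  refine ⟨2 * M, fun n hn => ?_⟩
  have hsum : ∑ p ∈ n.primeFactors, (d : ℝ) ^ (n / p) ≤ n * (d : ℝ) ^ (n / 2) := by
    exact_mod_cast sum_primeFactors_pow_div_le (by omega : 0 < d) n
  set m := n / 2 with hm
  have hd1 : (1 : ℝ) ≤ d := by exact_mod_cast (by omega : 1 ≤ d)
  have hMm : (M : ℝ) ≤ m := by exact_mod_cast (by omega : M ≤ m)
  have hnm : (n : ℝ) ≤ 2 * m + 1 := by exact_mod_cast (by omega : n ≤ 2 * m + 1)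
  have hE1 : (1 : ℝ) ≤ (d : ℝ) ^ m := one_le_pow₀ hd1
  have hEn : (d : ℝ) ^ m * (d : ℝ) ^ m ≤ (d : ℝ) ^ n := by
    rw [← pow_add]; exact pow_le_pow_right₀ hd1 (by omega)
  have hE : ((m : ℝ) + 1) ^ 2 ≤ 4 * (d : ℝ) ^ m := by
    have h := (sq_succ_le_four_mul_three_pow m).trans
      (Nat.mul_le_mul_left 4 (Nat.pow_le_pow_left hd m))
    exact_mod_cast h
  have hκm : 12 < κ * ((m : ℝ) + 1) := by
    rw [div_lt_iff₀ hκ] at hM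
    nlinarith
  have hlin : 2 * (m : ℝ) + 3 < κ * (d : ℝ) ^ m := by
    have h1 : 12 * ((m : ℝ) + 1) < κ * ((m : ℝ) + 1) * (m + 1) :=
      mul_lt_mul_of_pos_right hκm (by positivity)
    have h2 := mul_le_mul_of_nonneg_left hE hκ.le
    have h3 : (0 : ℝ) ≤ m := m.cast_nonneg
    nlinarith
  calc ∑ p ∈ n.primeFactors, (d : ℝ) ^ (n / p) + 2
      ≤ (2 * m + 1) * (d : ℝ) ^ m + 2 * (d : ℝ) ^ m := by
        have := mul_le_mul_of_nonneg_right hnm (by positivity : (0 : ℝ) ≤ (d : ℝ) ^ m)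
        linarith
    _ = (2 * m + 3) * (d : ℝ) ^ m := by ring
    _ < κ * (d : ℝ) ^ m * (d : ℝ) ^ m := mul_lt_mul_of_pos_right hlin (by linarith)
    _ ≤ κ * (d : ℝ) ^ n := by rw [mul_assoc]; gcongr

lemma four_mul_natAbs_le_den {u : ℤ} {c : ℚ} (hc0 : c ≠ 0)
    (hc : |c| * (4 * |(u : ℚ)|) < 1) : 4 * u.natAbs ≤ c.den := by
  have hden : (0 : ℚ) < c.den := by exact_mod_cast c.den_pos
  have hnum : (1 : ℚ) ≤ |(c.num : ℚ)| := by
    exact_mod_cast Int.one_le_abs (Rat.num_ne_zero.mpr hc0)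
  have habs : |c| = |(c.num : ℚ)| / c.den := by
    conv_lhs => rw [← Rat.num_div_den c, abs_div, Nat.abs_cast]
  rw [habs, div_mul_eq_mul_div, div_lt_one hden] at hc
  have h : 4 * |(u : ℚ)| ≤ c.den := by
    nlinarith [abs_nonneg (u : ℚ)]
  have hu : ((u.natAbs : ℤ) : ℚ) = |(u : ℚ)| := by rw [Int.natCast_natAbs]; push_cast; rfl
  rw [← hu] at h
  exact_mod_cast h

lemma log_abs_num_eq {x : ℚ} (hx : x ≠ 0) :
    Real.log |(x.num : ℝ)| = Real.log |(x : ℝ)| + Real.log x.den := by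
  have hden : (x.den : ℝ) ≠ 0 := by exact_mod_cast x.den_nz
  have hx' : (x : ℝ) ≠ 0 := by exact_mod_cast hx
  rw [← Real.log_mul (abs_ne_zero.mpr hx') hden]
  congr 1
  rw [Rat.cast_def, abs_div, Nat.abs_cast, div_mul_cancel₀ _ hden]

lemma log_abs_An_monomial_le {u : ℤ} (hu : u ≠ 0) {d : ℕ} (hd : 3 ≤ d) {c : ℚ} (hc0 : c ≠ 0)
    (hc : |c| * (4 * |(u : ℚ)|) < 1) (n : ℕ) :
    Real.log |(An (Polynomial.C u * Polynomial.X ^ d) c n : ℝ)| ≤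
      (d : ℝ) ^ n * Real.log c.den := by
  obtain ⟨hlo, hhi⟩ := gcIter_monomial_bounds hu hd hc n
  have hdvd := den_gcIter_monomial_dvd u (by omega : d ≠ 0) c n
  rw [An]
  set x := gcIter (Polynomial.C u * Polynomial.X ^ d) c (n + 1)
  have hcpos := abs_pos.mpr hc0
  have hx : x ≠ 0 := abs_pos.mp (by linarith)
  have hu1 : (1 : ℚ) ≤ |(u : ℚ)| := by exact_mod_cast Int.one_le_abs hu
  have hx1 : |x| ≤ 1 := by nlinarith
  have hx1' : |(x : ℝ)| ≤ 1 := by exact_mod_cast hx1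
  have hden : (x.den : ℝ) ≤ (c.den : ℝ) ^ d ^ n := by
    exact_mod_cast Nat.le_of_dvd (pow_pos c.den_pos _) hdvd
  have hlog := Real.log_le_log (by exact_mod_cast x.den_pos) hden
  rw [Real.log_pow, Nat.cast_pow] at hlog
  rw [log_abs_num_eq hx]
  linarith [Real.log_nonpos (abs_nonneg (x : ℝ)) hx1']

lemma log_abs_An_monomial_ge {u : ℤ} (hu : u ≠ 0) {d : ℕ} (hd : 3 ≤ d) {c : ℚ} (hc0 : c ≠ 0)
    (hc : |c| * (4 * |(u : ℚ)|) < 1) (n : ℕ) :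
    (d : ℝ) ^ n * ((Real.log c.den - Real.log u.natAbs) / 2) - 2 * Real.log c.den ≤
      Real.log |(An (Polynomial.C u * Polynomial.X ^ d) c n : ℝ)| := by
  obtain ⟨hlo, -⟩ := gcIter_monomial_bounds hu hd hc n
  have hB := log_den_gcIter_monomial_ge hu hd c n
  have h4 := four_mul_natAbs_le_den hc0 hc
  rw [An]
  set x := gcIter (Polynomial.C u * Polynomial.X ^ d) c (n + 1)
  have hcpos := abs_pos.mpr hc0
  have hx : x ≠ 0 := abs_pos.mp (by linarith)
  have hupos := Int.natAbs_pos.mpr hu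
  have hden2 : (2 : ℝ) ≤ c.den := by exact_mod_cast (by omega : 2 ≤ c.den)
  have hdenpos : (0 : ℝ) < c.den := by linarith
  have hnum : (1 : ℝ) ≤ |(c.num : ℝ)| := by
    exact_mod_cast Int.one_le_abs (Rat.num_ne_zero.mpr hc0)
  have hlo' : |(c : ℝ)| / 2 ≤ |(x : ℝ)| := by exact_mod_cast hlo
  have hcpos' : 0 < |(c : ℝ)| := by exact_mod_cast hcpos
  have hlogx := Real.log_le_log (by positivity) hlo'
  rw [Real.log_div hcpos'.ne' two_ne_zero] at hlogx
  have hlogc := log_abs_num_eq hc0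
  have hlog2 := Real.log_le_log two_pos hden2
  rw [log_abs_num_eq hx]
  linarith [Real.log_nonneg hnum, Real.log_natCast_nonneg c.den,
    Real.log_natCast_nonneg u.natAbs]

/-- Proposition 3.4: every `g(x) = u_d x^d ∈ ℤ[x]` of degree `d ≥ 3` has rapidly
increasing numerators on `(−1/(4|u_d|), 1/(4|u_d|)) ∩ S_g`. -/
theorem rapidly_increasing_numerators_monomial (u : ℤ) (hu : u ≠ 0)
    (d : ℕ) (hd : 3 ≤ d) :
    RapidlyIncreasingNumerators (Polynomial.C u * Polynomial.X ^ d)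
      ({c : ℚ | -(1 / (4 * |(u : ℚ)|)) < c ∧ c < 1 / (4 * |(u : ℚ)|)} ∩
        Sg (Polynomial.C u * Polynomial.X ^ d)) := by
  have hs : 0 ≤ Real.log u.natAbs := Real.log_natCast_nonneg _
  have hl4 : 0 < Real.log 4 := Real.log_pos (by norm_num)
  set κ := Real.log 4 / (Real.log u.natAbs + Real.log 4) with hκ
  have hκ0 : 0 < κ := by positivity
  obtain ⟨N, hN⟩ := exists_forall_sum_primeFactors_pow_lt hd (half_pos hκ0)
  refine ⟨N + 1, N.succ_pos, ?_⟩
  rintro c ⟨⟨hc1, hc2⟩, hcS⟩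
  refine ⟨Finset.range N, by simp, fun n _ hn => ?_⟩
  have hc0 := ne_zero_of_mem_Sg_monomial (by omega) hcS
  have hupos : (0 : ℚ) < |(u : ℚ)| := abs_pos.mpr (by exact_mod_cast hu)
  have hc : |c| * (4 * |(u : ℚ)|) < 1 :=
    (lt_div_iff₀ (by positivity)).mp (abs_lt.mpr ⟨hc1, hc2⟩)
  have h4 := four_mul_natAbs_le_den hc0 hc
  have hu1 : (1 : ℝ) ≤ u.natAbs := by exact_mod_cast Int.natAbs_pos.mpr hu
  have ht : Real.log 4 + Real.log u.natAbs ≤ Real.log c.den := by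
    rw [← Real.log_mul (by norm_num) (by linarith)]
    exact Real.log_le_log (by linarith) (by exact_mod_cast h4)
  have hκt : κ * Real.log c.den ≤ Real.log c.den - Real.log u.natAbs := by
    rw [hκ, div_mul_eq_mul_div, div_le_iff₀ (by linarith)]
    nlinarith
  have hlow := log_abs_An_monomial_ge hu hd hc0 hc n
  have hmain := hN n (by simpa using hn)
  have hdn : (0 : ℝ) ≤ (d : ℝ) ^ n := by positivity
  calc ∑ p ∈ n.primeFactors,
        Real.log |(An (Polynomial.C u * Polynomial.X ^ d) c (n / p) : ℝ)|
      ≤ ∑ p ∈ n.primeFactors, (d : ℝ) ^ (n / p) * Real.log c.den :=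
        Finset.sum_le_sum fun p _ => log_abs_An_monomial_le hu hd hc0 hc _
    _ = (∑ p ∈ n.primeFactors, (d : ℝ) ^ (n / p)) * Real.log c.den :=
        (Finset.sum_mul _ _ _).symm
    _ < (κ / 2 * (d : ℝ) ^ n - 2) * Real.log c.den :=
        mul_lt_mul_of_pos_right (by linarith) (by linarith)
    _ ≤ (d : ℝ) ^ n * ((Real.log c.den - Real.log u.natAbs) / 2) - 2 * Real.log c.den := by
        nlinarith [mul_le_mul_of_nonneg_left hκt hdn]
    _ ≤ _ := hlow
end
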